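/- arXiv:2006.00466 — 2 statements merged into one kernel-verified Lean document; each statement's English description precedes it below -/
import Mathlib

section
/- Let A be a finite skew brace such that the additive group A_⊕ is solvable and such that every skew brace of strictly smaller cardinality whose additive group is solvable has solvable multiplicative group. If the multiplicative group A_⊙ is not solvable, then A_⊙ is not a simple group. -/
/-- A skew brace: a set with two group operations `⊕` (written `+`) and `⊙` (written `*`)
satisfying `a ⊙ (b ⊕ c) = (a ⊙ b) ⊖ a ⊕ (a ⊙ c)`. -/
class SkewBrace (A : Type*) extends AddGroup A, Group A where
  compat : ∀ a b c : A, a * (b + c) = a * b + -a + a * c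

/-- A normalised sum of `n`-th roots of unity which is an algebraic integer either vanishes or has
all its terms equal. -/
theorem Multiset.sum_eq_zero_or_forall_eq_of_isIntegral {n : ℕ} (hn : 0 < n) (s : Multiset ℂ)
    (hs : ∀ z ∈ s, z ^ n = 1) (hintegral : IsIntegral ℤ (s.sum / s.card)) :
    s.sum = 0 ∨ ∃ c, ∀ z ∈ s, z = c := by
  classical
  by_cases hcard : s.card = 0
  · left
    rw [Multiset.card_eq_zero] at hcard
    simp [hcard]
  have hd : (0 : ℝ) < s.card := by exact_mod_cast Nat.pos_of_ne_zero hcard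
  let K := IntermediateField.adjoin ℚ {z : ℂ | z ^ n = 1}
  have hfin : {z : ℂ | z ^ n = 1}.Finite := by
    have h := (Polynomial.nthRootsFinset n (1 : ℂ)).finite_toSet
    refine h.subset fun z hz => ?_
    simpa [Polynomial.mem_nthRootsFinset hn] using hz
  have : Finite {z : ℂ | z ^ n = 1} := hfin
  have : FiniteDimensional ℚ K := by
    refine IntermediateField.finiteDimensional_adjoin fun z hz => ?_
    refine ⟨Polynomial.X ^ n - 1, Polynomial.monic_X_pow_sub_C 1 hn.ne', ?_⟩
    have hz' : z ^ n = 1 := hz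
    simp [hz']
  have : NumberField K := ⟨⟩
  obtain ⟨t, rfl⟩ : ∃ t : Multiset K, t.map (algebraMap K ℂ) = s := by
    have hK : ∀ z ∈ s, z ∈ K := fun z hz => IntermediateField.subset_adjoin _ _ (hs z hz)
    lift s to Multiset K using hK
    exact ⟨s, rfl⟩
  have ht : ∀ z ∈ t, z ^ n = 1 := fun z hz => by
    have := hs _ (Multiset.mem_map_of_mem _ hz)
    rw [← map_pow] at this
    exact (algebraMap K ℂ).injective (by rw [this, map_one])
  simp only [Multiset.card_map] at hintegral hcard hd
  have hsum : (t.map (algebraMap K ℂ)).sum = algebraMap K ℂ t.sum :=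
    ((algebraMap K ℂ).toAddMonoidHom.map_multiset_sum t).symm
  set x : K := t.sum / t.card with hx
  have hxa : algebraMap K ℂ x = (t.map (algebraMap K ℂ)).sum / t.card := by
    rw [hx, map_div₀, hsum, map_natCast]
  rw [← hxa] at hintegral
  have hxint : IsIntegral ℤ x := (isIntegral_algebraMap_iff (algebraMap K ℂ).injective).1 hintegral
  have hnorm : ∀ φ : K →+* ℂ, ‖φ x‖ ≤ 1 := fun φ => by
    have h1 : φ t.sum = (t.map φ).sum := φ.toAddMonoidHom.map_multiset_sum t
    have h2 : ‖(t.map φ).sum‖ ≤ ((t.map φ).map norm).sum := norm_multiset_sum_le _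
    have h3 : (t.map φ).map norm = t.map fun _ => (1 : ℝ) := by
      rw [Multiset.map_map]
      refine Multiset.map_congr rfl fun z hz => ?_
      refine Complex.norm_eq_one_of_pow_eq_one (n := n) ?_ hn.ne'
      rw [← map_pow, ht z hz, map_one]
    rw [h3] at h2
    simp only [Multiset.map_const', Multiset.sum_replicate, nsmul_eq_mul, mul_one] at h2
    rw [hx, map_div₀, map_natCast, h1, norm_div, Complex.norm_natCast, div_le_one hd]
    exact h2
  by_cases hx0 : x = 0
  · left
    rw [hx0, _root_.map_zero, eq_comm, div_eq_zero_iff] at hxa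
    exact hxa.resolve_right (by exact_mod_cast hcard)
  right
  obtain ⟨k, hk, hxk⟩ := NumberField.Embeddings.pow_eq_one_of_norm_le_one K ℂ hx0 hxint hnorm
  set a := algebraMap K ℂ x with ha
  have hanorm : ‖a‖ = 1 := by
    refine Complex.norm_eq_one_of_pow_eq_one (n := k) ?_ hk.ne'
    rw [ha, ← map_pow, hxk, map_one]
  refine ⟨a, ?_⟩
  set s := t.map (algebraMap K ℂ) with hsdef
  have hscard : s.card = t.card := by simp [hsdef]
  have hssum : s.sum = t.card * a := by
    rw [hxa]; field_simp
  have haa : a * (starRingEnd ℂ) a = 1 := by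
    rw [Complex.mul_conj, Complex.normSq_eq_norm_sq, hanorm]; simp
  let r : ℂ → ℝ := fun z => 1 - (z * (starRingEnd ℂ) a).re
  have hr0 : ∀ z ∈ s, 0 ≤ r z ∧ (r z = 0 → z = a) := fun z hz => by
    have hz1 : ‖z‖ = 1 := Complex.norm_eq_one_of_pow_eq_one (hs z hz) hn.ne'
    have hw : ‖z * (starRingEnd ℂ) a‖ = 1 := by simp [hz1, hanorm]
    have hle := Complex.re_le_norm (z * (starRingEnd ℂ) a)
    refine ⟨by simp only [r]; linarith, fun h => ?_⟩
    have hre : (z * (starRingEnd ℂ) a).re = 1 := by simp only [r] at h; linarith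
    have hone : z * (starRingEnd ℂ) a = 1 := by
      have hsq := Complex.sq_norm (z * (starRingEnd ℂ) a)
      rw [hw, Complex.normSq_apply, hre] at hsq
      have him : (z * (starRingEnd ℂ) a).im = 0 := by nlinarith
      exact Complex.ext (by simpa using hre) (by simpa using him)
    calc z = z * (a * (starRingEnd ℂ) a) := by rw [haa, mul_one]
      _ = (z * (starRingEnd ℂ) a) * a := by ring
      _ = a := by rw [hone, one_mul]
  have hrsum : (s.map r).sum = 0 := by
    have h1 : (s.map r).sum = s.card - (s.sum * (starRingEnd ℂ) a).re := by
      clear_value s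
      clear * -
      induction s using Multiset.induction_on with
      | empty => simp
      | cons z s ih => simp only [Multiset.map_cons, Multiset.sum_cons, ih, r, Multiset.card_cons,
          add_mul, Complex.add_re]; push_cast; ring
    rw [h1, hssum, mul_assoc, haa, hscard]
    simp
  intro z hz
  refine (hr0 z hz).2 ?_
  have hle : r z ≤ (s.map r).sum := by
    refine Multiset.single_le_sum ?_ _ (Multiset.mem_map_of_mem r hz)
    intro y hy
    obtain ⟨w, hw, rfl⟩ := Multiset.mem_map.1 hy
    exact (hr0 w hw).1
  exact le_antisymm (hrsum ▸ hle) (hr0 z hz).1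

/-- A complex matrix of finite order whose normalised trace is an algebraic integer is traceless
or scalar. -/
theorem Matrix.trace_eq_zero_or_scalar_of_isIntegral {n d : ℕ} (hn : 0 < n) [NeZero d]
    (X : Matrix (Fin d) (Fin d) ℂ) (hX : X ^ n = 1) (hintegral : IsIntegral ℤ (X.trace / d)) :
    X.trace = 0 ∨ ∃ c : ℂ, X = Matrix.scalar (Fin d) c := by
  have hcard : X.charpoly.roots.card = d := by
    rw [← (IsAlgClosed.splits X.charpoly).natDegree_eq_card_roots, Matrix.charpoly_natDegree_eq_dim,
      Fintype.card_fin]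
  have hroot : ∀ z ∈ X.charpoly.roots, z ^ n = 1 := fun z hz => by
    have hz1 := Matrix.mem_spectrum_of_isRoot_charpoly (Polynomial.isRoot_of_mem_roots hz)
    have hz2 := spectrum.pow_mem_pow X n hz1
    rw [hX] at hz2
    simpa using hz2
  rw [Matrix.trace_eq_sum_roots_charpoly] at hintegral ⊢
  refine (Multiset.sum_eq_zero_or_forall_eq_of_isIntegral hn _ hroot
    (by rwa [hcard])).imp_right ?_
  rintro ⟨c, hc⟩
  refine ⟨c, ?_⟩
  have hchar : X.charpoly = (Polynomial.X - Polynomial.C c) ^ d := by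
    have h1 := (IsAlgClosed.splits X.charpoly).eq_prod_roots_of_monic X.charpoly_monic
    rw [Multiset.eq_replicate.2 ⟨hcard, hc⟩] at h1
    simpa using h1
  have hsq : Squarefree (minpoly ℂ X) := by
    have hsep : (Polynomial.X ^ n - Polynomial.C 1 : Polynomial ℂ).Separable :=
      Polynomial.separable_X_pow_sub_C 1 (by exact_mod_cast hn.ne') one_ne_zero
    refine hsep.squarefree.squarefree_of_dvd (minpoly.dvd ℂ X ?_)
    simp [hX]
  have hdvd : minpoly ℂ X ∣ (Polynomial.X - Polynomial.C c) := by
    refine (hsq.dvd_pow_iff_dvd (NeZero.ne d)).1 ?_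
    rw [← hchar]
    exact minpoly.dvd ℂ X (Matrix.aeval_self_charpoly X)
  have h := (minpoly.dvd_iff).1 hdvd
  simp only [map_sub, Polynomial.aeval_X, Polynomial.aeval_C] at h
  rw [sub_eq_zero.1 h]
  rfl

/-- The trace of left multiplication on a finite product of matrix algebras. -/
theorem Matrix.trace_mulLeft_pi {n : ℕ} {d : Fin n → ℕ}
    (X : Π i, Matrix (Fin (d i)) (Fin (d i)) ℂ) :
    LinearMap.trace ℂ _ (LinearMap.mulLeft ℂ X) = ∑ i, (d i : ℂ) * (X i).trace := by
  classical
  let b := Pi.basis fun i => Matrix.stdBasis ℂ (Fin (d i)) (Fin (d i))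
  rw [LinearMap.trace_eq_matrix_trace ℂ b, Matrix.trace, Fintype.sum_sigma]
  refine Finset.sum_congr rfl fun i _ => ?_
  rw [Fintype.sum_prod_type, Matrix.trace, Finset.mul_sum]
  refine Finset.sum_congr rfl fun a _ => ?_
  have : ∀ c : Fin (d i), (LinearMap.toMatrix b b (LinearMap.mulLeft ℂ X)).diag ⟨i, (a, c)⟩
      = X i a a := fun c => by
    rw [Matrix.diag_apply, LinearMap.toMatrix_apply]
    simp only [b, Pi.basis_repr, LinearMap.mulLeft_apply, Pi.mul_apply, Pi.basis_apply,
      Pi.single_eq_same, Matrix.stdBasis_eq_single]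
    have h : ∀ M : Matrix (Fin (d i)) (Fin (d i)) ℂ,
        (Matrix.stdBasis ℂ (Fin (d i)) (Fin (d i))).repr M (a, c) = M a c := fun M => by
      simp [Matrix.stdBasis]
    rw [h]
    simp
  rw [Finset.sum_congr rfl fun c _ => this c]
  simp

/-- The trace of left multiplication by a nontrivial group element on the group algebra. -/
theorem MonoidAlgebra.trace_mulLeft_single {G : Type*} [Group G] [Finite G] {g : G} (hg : g ≠ 1) :
    LinearMap.trace ℂ _ (LinearMap.mulLeft ℂ (MonoidAlgebra.single g (1 : ℂ))) = 0 := by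
  classical
  have := Fintype.ofFinite G
  let b : Module.Basis G ℂ (MonoidAlgebra ℂ G) := MonoidAlgebra.basis G ℂ
  rw [LinearMap.trace_eq_matrix_trace ℂ b, Matrix.trace]
  refine Finset.sum_eq_zero fun x _ => ?_
  rw [Matrix.diag_apply, LinearMap.toMatrix_apply]
  simp only [b, MonoidAlgebra.basis_apply, LinearMap.mulLeft_apply,
    MonoidAlgebra.single_mul_single, mul_one]
  change (MonoidAlgebra.single (g * x) (1 : ℂ)).coeff x = 0
  simp [hg]

/-- The sum over a conjugacy class in the integral group ring is integral. -/
theorem MonoidAlgebra.isIntegral_sum_single {G : Type*} [Group G] [Finite G] (s : Finset G) :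
    IsIntegral ℤ (∑ x ∈ s, MonoidAlgebra.single x (1 : ℂ)) := by
  have h : IsIntegral ℤ (∑ x ∈ s, MonoidAlgebra.single x (1 : ℤ)) := IsIntegral.of_finite ℤ _
  have h2 := h.map (MonoidAlgebra.mapRingHom G (Int.castRingHom ℂ)).toIntAlgHom
  simpa using h2

theorem Matrix.isIntegral_trace_of_pow_eq_one {n d : ℕ} (hn : 0 < n) [NeZero d]
    (X : Matrix (Fin d) (Fin d) ℂ) (hX : X ^ n = 1) : IsIntegral ℤ X.trace := by
  rw [Matrix.trace_eq_sum_roots_charpoly]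
  refine IsIntegral.multiset_sum fun z hz => ?_
  have hz1 := Matrix.mem_spectrum_of_isRoot_charpoly (Polynomial.isRoot_of_mem_roots hz)
  have hz2 := spectrum.pow_mem_pow X n hz1
  rw [hX] at hz2
  have hz3 : z ^ n = 1 := by simpa using hz2
  exact IsIntegral.of_pow hn (hz3 ▸ isIntegral_one)

theorem Matrix.eq_scalar_of_forall_commute {d : ℕ} (X : Matrix (Fin d) (Fin d) ℂ)
    (h : ∀ M, M * X = X * M) : ∃ c : ℂ, X = Matrix.scalar (Fin d) c := by
  have : X ∈ Set.center (Matrix (Fin d) (Fin d) ℂ) :=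
    Semigroup.mem_center_iff.2 h
  rw [Matrix.center_eq_range] at this
  exact this.imp fun c hc => hc.symm

/-- An element of the group algebra that commutes with the group elements is central. -/
theorem MonoidAlgebra.mul_comm_of_forall_single {G : Type*} [Group G] (c : MonoidAlgebra ℂ G)
    (h : ∀ y : G, MonoidAlgebra.single y 1 * c = c * MonoidAlgebra.single y 1)
    (r : MonoidAlgebra ℂ G) : r * c = c * r := by
  induction r using MonoidAlgebra.induction_on with
  | of y => simpa using h y
  | add a b ha hb => rw [add_mul, mul_add, ha, hb]
  | smul t a ha => rw [smul_mul_assoc, mul_smul_comm, ha]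

/-- **Burnside's theorem**: in a finite insoluble simple group no nontrivial conjugacy class has
prime power cardinality. -/
theorem IsSimpleGroup.card_conj_ne_prime_pow {G : Type*} [Group G] [Finite G] [IsSimpleGroup G]
    (hG : ¬ Group.IsSolvable G) {g : G} (hg : g ≠ 1) (C : Finset G) (hC : ∀ x, x ∈ C ↔ IsConj g x)
    {q : ℕ} (hq : q.Prime) (k : ℕ) : C.card ≠ q ^ k := by
  classical
  intro hcard
  have := Fintype.ofFinite G
  obtain ⟨n, d, hd, ⟨e⟩⟩ :=
    IsSemisimpleRing.exists_algEquiv_pi_matrix_of_isAlgClosed ℂ (MonoidAlgebra ℂ G)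
  let π : ∀ i, MonoidAlgebra ℂ G →ₐ[ℂ] Matrix (Fin (d i)) (Fin (d i)) ℂ := fun i =>
    (Pi.evalAlgHom ℂ _ i).comp e.toAlgHom
  have hπsurj : ∀ i M, ∃ r, π i r = M ∧ ∀ j, j ≠ i → π j r = 0 := fun i M =>
    ⟨e.symm (Pi.single i M), by simp [π], fun j hj => by simp [π, hj]⟩
  let ρ : ∀ i, G →* Matrix (Fin (d i)) (Fin (d i)) ℂ := fun i =>
    (π i : MonoidAlgebra ℂ G →* _).comp (MonoidAlgebra.of ℂ G)
  have hρ : ∀ i x, ρ i x = π i (MonoidAlgebra.single x 1) := fun i x => rfl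
  have hN : 0 < Fintype.card G := Fintype.card_pos
  have hpow : ∀ i x, ρ i x ^ Fintype.card G = 1 := fun i x => by
    rw [← map_pow, pow_card_eq_one, map_one]
  have hscalar : ∀ i (c : MonoidAlgebra ℂ G),
      (∀ y : G, MonoidAlgebra.single y 1 * c = c * MonoidAlgebra.single y 1) →
      ∃ w : ℂ, π i c = Matrix.scalar _ w := fun i c hc => by
    refine Matrix.eq_scalar_of_forall_commute _ fun M => ?_
    obtain ⟨r, rfl, -⟩ := hπsurj i M
    rw [← map_mul, ← map_mul, MonoidAlgebra.mul_comm_of_forall_single c hc]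
  have htriv : ∀ i, (ρ i).ker = ⊤ ∨ (ρ i g).trace = 0 ∨ q ∣ d i := fun i => by
    by_cases hqd : q ∣ d i
    · exact Or.inr (Or.inr hqd)
    obtain ⟨w, hw⟩ := hscalar i (∑ x ∈ C, MonoidAlgebra.single x 1) fun y => by
      rw [Finset.mul_sum, Finset.sum_mul]
      simp only [MonoidAlgebra.single_mul_single, mul_one]
      refine Finset.sum_bij (fun x _ => y * x * y⁻¹) ?_ ?_ ?_ ?_
      · intro x hx
        rw [hC] at hx ⊢
        exact hx.trans (isConj_iff.2 ⟨y, rfl⟩)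
      · intro a _ b _ h
        simpa using h
      · intro b hb
        refine ⟨y⁻¹ * b * y, ?_, by group⟩
        rw [hC] at hb ⊢
        exact hb.trans (isConj_iff.2 ⟨y⁻¹, by group⟩)
      · intro x _
        simp
    have hwint : IsIntegral ℤ w := by
      have h1 := (MonoidAlgebra.isIntegral_sum_single C).map ((π i).restrictScalars ℤ)
      have h2 : IsIntegral ℤ (algebraMap ℂ (Matrix (Fin (d i)) (Fin (d i)) ℂ) w) := by
        have h3 : (π i).restrictScalars ℤ (∑ x ∈ C, MonoidAlgebra.single x (1 : ℂ))
            = algebraMap ℂ (Matrix (Fin (d i)) (Fin (d i)) ℂ) w := hw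
        rwa [h3] at h1
      exact (isIntegral_algebraMap_iff (FaithfulSMul.algebraMap_injective ℂ _)).1 h2
    have htr : (C.card : ℂ) * (ρ i g).trace = d i * w := by
      have h1 := congrArg Matrix.trace hw
      rw [map_sum, Matrix.trace_sum] at h1
      have h2 : ∀ x ∈ C, (π i (MonoidAlgebra.single x 1)).trace = (ρ i g).trace := fun x hx => by
        obtain ⟨y, rfl⟩ := isConj_iff.1 ((hC x).1 hx)
        rw [← hρ, map_mul, Matrix.trace_mul_comm, ← map_mul]
        congr 2
        group
      rw [Finset.sum_congr rfl h2] at h1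
      simpa using h1
    have hχ := Matrix.isIntegral_trace_of_pow_eq_one hN _ (hpow i g)
    have hd0 : (d i : ℂ) ≠ 0 := by exact_mod_cast (hd i).ne
    have hintegral : IsIntegral ℤ ((ρ i g).trace / d i) := by
      have hcop : IsCoprime (C.card : ℤ) (d i : ℤ) := by
        rw [hcard]
        exact Nat.isCoprime_iff_coprime.2
          (Nat.Coprime.pow_left k ((Nat.Prime.coprime_iff_not_dvd hq).2 hqd))
      obtain ⟨u, v, huv⟩ := hcop
      have huv' : (u : ℂ) * C.card + v * d i = 1 := by exact_mod_cast huv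
      have : (ρ i g).trace / d i = u • w + v • (ρ i g).trace := by
        rw [div_eq_iff hd0, zsmul_eq_mul, zsmul_eq_mul]
        linear_combination (-(ρ i g).trace) * huv' + (u : ℂ) * htr
      rw [this]
      exact (hwint.smul u).add (hχ.smul v)
    rcases Matrix.trace_eq_zero_or_scalar_of_isIntegral hN _ (hpow i g) hintegral with h | ⟨c, hc⟩
    · exact Or.inr (Or.inl h)
    left
    let S : Subgroup G :=
      { carrier := {x | ∀ y, Commute (ρ i x) (ρ i y)}
        mul_mem' := fun {a b} ha hb y => by
          rw [map_mul]
          exact (ha y).mul_left (hb y)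
        one_mem' := fun y => by
          rw [map_one]
          exact Commute.one_left _
        inv_mem' := fun {a} ha y => by
          have h := (ha (a⁻¹ * y * a)).eq
          have h1 : ρ i a⁻¹ * (ρ i a * ρ i (a⁻¹ * y * a)) * ρ i a⁻¹
              = ρ i a⁻¹ * (ρ i (a⁻¹ * y * a) * ρ i a) * ρ i a⁻¹ := by rw [h]
          simp only [← map_mul] at h1
          have h2 : a⁻¹ * (a * (a⁻¹ * y * a)) * a⁻¹ = a⁻¹ * y := by group
          have h3 : a⁻¹ * (a⁻¹ * y * a * a) * a⁻¹ = a⁻¹ * (a⁻¹ * y * a) := by group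
          have h4 := (ha (a⁻¹ * y)).eq
          simp only [← map_mul] at h4
          rw [h2, h3] at h1
          change ρ i a⁻¹ * ρ i y = ρ i y * ρ i a⁻¹
          rw [← map_mul, ← map_mul]
          have h5 : ρ i (a * (a⁻¹ * y) * a⁻¹) = ρ i (a⁻¹ * y * a * a⁻¹) := by
            rw [map_mul, h4, ← map_mul]
          rw [show a * (a⁻¹ * y) * a⁻¹ = y * a⁻¹ by group,
            show a⁻¹ * y * a * a⁻¹ = a⁻¹ * y by group] at h5
          exact h5.symm }
    have hSn : S.Normal := ⟨fun x hx y z => by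
      have h := (hx (y⁻¹ * z * y)).eq
      rw [← map_mul, ← map_mul] at h
      have h1 : ρ i y * ρ i (x * (y⁻¹ * z * y)) * ρ i y⁻¹
          = ρ i y * ρ i (y⁻¹ * z * y * x) * ρ i y⁻¹ := by rw [h]
      simp only [← map_mul] at h1
      change ρ i (y * x * y⁻¹) * ρ i z = ρ i z * ρ i (y * x * y⁻¹)
      rw [← map_mul, ← map_mul]
      convert h1 using 2 <;> group⟩
    have hgS : g ∈ S := fun y => by
      rw [hc]
      exact Matrix.scalar_commute c (fun r => mul_comm _ _) _
    have hS : S = ⊤ := (hSn.eq_bot_or_eq_top).resolve_left fun h => hg (by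
      rw [h] at hgS
      exact hgS)
    refine ((ρ i).normal_ker.eq_bot_or_eq_top).resolve_left fun hker => hG ?_
    refine Group.isSolvable_of_comm fun a b => ?_
    refine ((ρ i).ker_eq_bot_iff.1 hker) ?_
    have ha : a ∈ S := hS ▸ Subgroup.mem_top a
    rw [map_mul, map_mul]
    exact (ha b).eq
  have htriv_scalar : ∀ i, (ρ i).ker = ⊤ → ∀ r, ∃ t : ℂ, ∀ j, (ρ j).ker = ⊤ →
      π j r = Matrix.scalar _ t := fun i _ r => by
    induction r using MonoidAlgebra.induction_on with
    | of y =>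
      refine ⟨1, fun j hj => ?_⟩
      have : ρ j y = 1 := by
        rw [← MonoidHom.mem_ker, hj]
        exact Subgroup.mem_top y
      rw [map_one]
      exact this
    | add a b ha hb =>
      obtain ⟨s, hs⟩ := ha
      obtain ⟨t, ht⟩ := hb
      exact ⟨s + t, fun j hj => by rw [map_add, hs j hj, ht j hj, map_add]⟩
    | smul c a ha =>
      obtain ⟨s, hs⟩ := ha
      refine ⟨c * s, fun j hj => ?_⟩
      rw [map_smul, hs j hj]
      ext a b
      simp [Matrix.diagonal_apply]
  have hd1 : ∀ i, (ρ i).ker = ⊤ → d i = 1 := fun i hi => by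
    by_contra hne
    have hlt : 1 < d i := lt_of_le_of_ne (Nat.one_le_iff_ne_zero.2 (hd i).ne) (Ne.symm hne)
    obtain ⟨r, hr, -⟩ := hπsurj i (Matrix.single ⟨0, by lia⟩ ⟨1, hlt⟩ 1)
    obtain ⟨t, ht⟩ := htriv_scalar i hi r
    have h := congrFun (congrFun (hr.symm.trans (ht i hi)) ⟨0, by lia⟩) ⟨1, hlt⟩
    simp at h
  obtain ⟨i₀, hi₀⟩ : ∃ i, (ρ i).ker = ⊤ := by
    set s : MonoidAlgebra ℂ G := ∑ x, MonoidAlgebra.single x 1 with hs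
    have hys : ∀ y : G, MonoidAlgebra.single y 1 * s = s := fun y => by
      rw [hs, Finset.mul_sum]
      simp only [MonoidAlgebra.single_mul_single, mul_one]
      exact Fintype.sum_equiv (Equiv.mulLeft y) _ _ fun x => rfl
    have hsy : ∀ y : G, s * MonoidAlgebra.single y 1 = s := fun y => by
      rw [hs, Finset.sum_mul]
      simp only [MonoidAlgebra.single_mul_single, mul_one]
      exact Fintype.sum_equiv (Equiv.mulRight y) _ _ fun x => rfl
    have hs0 : s ≠ 0 := fun h => by
      have h1 := congrArg (fun r : MonoidAlgebra ℂ G => r.coeff 1) h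
      simp [hs, Finsupp.single_apply] at h1
    have hes : e s ≠ 0 := fun h => hs0 (by simpa using h)
    obtain ⟨i, hi⟩ := Function.ne_iff.1 hes
    refine ⟨i, ?_⟩
    obtain ⟨w, hw⟩ := hscalar i s fun y => by rw [hys, hsy]
    have hw0 : w ≠ 0 := by
      rintro rfl
      have h : π i s = 0 := by simpa using hw
      exact hi h
    rw [eq_top_iff]
    intro y _
    rw [MonoidHom.mem_ker]
    have h := congrArg (π i) (hys y)
    rw [map_mul, ← hρ, hw] at h
    have h' : w • ρ i y = w • 1 := by
      ext a b
      have := congrFun (congrFun h a) b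
      simpa [Matrix.mul_diagonal, mul_comm, Matrix.one_apply, Matrix.diagonal_apply] using this
    exact smul_right_injective _ hw0 h'
  have huniq : ∀ i, (ρ i).ker = ⊤ → i = i₀ := fun i hi => by
    by_contra hne
    obtain ⟨r, hr, hr'⟩ := hπsurj i 1
    obtain ⟨t, ht⟩ := htriv_scalar i hi r
    have h0 := (hr' i₀ (Ne.symm hne)).symm.trans (ht i₀ hi₀)
    have h1 := hr.symm.trans (ht i hi)
    have h0' := congrFun (congrFun h0 0) 0
    have h1' := congrFun (congrFun h1 0) 0
    simp at h0' h1'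
    rw [← h0'] at h1'
    exact one_ne_zero h1'
  have hsum : ∑ i, (d i : ℂ) * (ρ i g).trace = 0 := by
    rw [← MonoidAlgebra.trace_mulLeft_single hg, ← LinearMap.trace_conj' _ e.toLinearEquiv,
      ← Matrix.trace_mulLeft_pi]
    congr 1
    refine LinearMap.ext fun M => ?_
    change (fun i => ρ i g) * M = e (MonoidAlgebra.single g 1 * e.symm M)
    rw [map_mul, e.apply_symm_apply]
    rfl
  have hone : (d i₀ : ℂ) * (ρ i₀ g).trace = 1 := by
    have : ρ i₀ g = 1 := by
      rw [← MonoidHom.mem_ker, hi₀]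
      exact Subgroup.mem_top g
    rw [this, Matrix.trace_one, Fintype.card_fin, hd1 i₀ hi₀]
    simp
  rw [← Finset.add_sum_erase _ _ (Finset.mem_univ i₀), hone] at hsum
  have hq0 : (q : ℂ) ≠ 0 := by exact_mod_cast hq.ne_zero
  have hintegral : IsIntegral ℤ ((∑ i ∈ Finset.univ.erase i₀, (d i : ℂ) * (ρ i g).trace) / q) := by
    rw [Finset.sum_div]
    refine IsIntegral.sum _ fun i hi => ?_
    rcases htriv i with h | h | ⟨m, hm⟩
    · exact absurd (huniq i h) (Finset.ne_of_mem_erase hi)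
    · rw [h]
      simpa using isIntegral_zero
    · have : (d i : ℂ) * (ρ i g).trace / q = m • (ρ i g).trace := by
        have hm' : (d i : ℂ) = q * m := by exact_mod_cast hm
        rw [hm', nsmul_eq_mul]
        field_simp
      rw [this]
      exact (Matrix.isIntegral_trace_of_pow_eq_one hN _ (hpow i g)).smul m
  rw [(neg_eq_of_add_eq_zero_right hsum).symm] at hintegral
  have hintegral' : IsIntegral ℤ ((-1 : ℚ) / q) := by
    refine (isIntegral_algebraMap_iff (B := ℂ) (algebraMap ℚ ℂ).injective).1 ?_
    simpa using hintegral
  obtain ⟨z, hz⟩ := IsIntegrallyClosed.isIntegral_iff.1 hintegral'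
  have hq0' : (q : ℚ) ≠ 0 := by exact_mod_cast hq.ne_zero
  rw [eq_div_iff hq0'] at hz
  have hz' : z * (q : ℤ) = -1 := by
    have : ((z * (q : ℤ) : ℤ) : ℚ) = ((-1 : ℤ) : ℚ) := by push_cast; simpa using hz
    exact_mod_cast this
  have : (q : ℤ) ∣ 1 := ⟨-z, by linarith⟩
  exact hq.one_lt.ne' (by exact_mod_cast Int.eq_one_of_dvd_one (by positivity) this)

theorem Nat.prod_range_pow_sub_one_lt {p : ℕ} (hp : 1 < p) {u : ℕ} (hu : 0 < u) :
    ∏ i ∈ Finset.range u, (p ^ (i + 1) - 1) < p ^ (∑ i ∈ Finset.range u, (i + 1)) := by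
  rw [← Finset.prod_pow_eq_pow_sum]
  refine Finset.prod_lt_prod_of_nonempty (fun i _ => ?_) (fun i _ => ?_) (by simpa using hu.ne')
  · have := Nat.one_lt_pow i.succ_ne_zero hp
    lia
  · have := Nat.one_lt_pow i.succ_ne_zero hp
    lia

theorem Nat.prod_range_pow_sub_pow (p u : ℕ) :
    ∏ i ∈ Finset.range u, (p ^ u - p ^ i) =
      p ^ (∑ i ∈ Finset.range u, i) * ∏ i ∈ Finset.range u, (p ^ (i + 1) - 1) := by
  rw [← Finset.prod_pow_eq_pow_sum, ← Finset.prod_range_reflect (fun i => p ^ (i + 1) - 1),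
    ← Finset.prod_mul_distrib]
  refine Finset.prod_congr rfl fun i hi => ?_
  have hi := Finset.mem_range.1 hi
  rw [Nat.mul_sub, mul_one, ← pow_add]
  congr 2
  lia

theorem Nat.sq_sum_range_lt_five_pow (u : ℕ) :
    (u * (u + 1)) ^ 2 < 4 * 5 ^ u := by
  induction u with
  | zero => norm_num
  | succ u ih =>
    rcases Nat.lt_or_ge u 2 with h | h
    · interval_cases u <;> norm_num
    · have : ((u + 1) * (u + 1 + 1)) ^ 2 ≤ 5 * (u * (u + 1)) ^ 2 := by
        rw [mul_pow, mul_pow]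
        nlinarith [Nat.mul_le_mul_left ((u + 1) ^ 2)
          (show (u + 1 + 1) ^ 2 ≤ 5 * u ^ 2 by nlinarith)]
      rw [pow_succ 5]
      lia

theorem Nat.sq_sum_range_lt_three_pow {u : ℕ} (hu : 5 ≤ u) :
    (u * (u + 1)) ^ 2 < 4 * 3 ^ u := by
  induction u, hu using Nat.le_induction with
  | base => norm_num
  | succ u h ih =>
    have : ((u + 1) * (u + 1 + 1)) ^ 2 ≤ 3 * (u * (u + 1)) ^ 2 := by
      rw [mul_pow, mul_pow]
      nlinarith [Nat.mul_le_mul_left ((u + 1) ^ 2) (show (u + 1 + 1) ^ 2 ≤ 3 * u ^ 2 by nlinarith)]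
    rw [pow_succ 3]
    lia

theorem Nat.sq_sum_range_lt_two_pow {u : ℕ} (hu : 14 ≤ u) :
    (u * (u + 1)) ^ 2 < 4 * 2 ^ u := by
  induction u, hu using Nat.le_induction with
  | base => norm_num
  | succ u h ih =>
    have : ((u + 1) * (u + 1 + 1)) ^ 2 ≤ 2 * (u * (u + 1)) ^ 2 := by
      rw [mul_pow, mul_pow]
      nlinarith [Nat.mul_le_mul_left ((u + 1) ^ 2) (show (u + 1 + 1) ^ 2 ≤ 2 * u ^ 2 by nlinarith)]
    rw [pow_succ 2]
    lia

/-- A prime-to-`p` number `f > p` cannot have a large power dividing the order of `GL_u(p)`. -/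
theorem Nat.not_pow_dvd_prod_pow_sub_pow {p f u w : ℕ} (hp : p.Prime) (hf : p < f)
    (hfp : f.Coprime p) (hu : 0 < u) (huw : p ^ u ≤ w ^ 2) :
    ¬ f ^ w ∣ ∏ i ∈ Finset.range u, (p ^ u - p ^ i) := by
  rw [Nat.prod_range_pow_sub_pow]
  intro h
  have hdvd := (Nat.Coprime.pow w _ hfp).dvd_of_dvd_mul_left h
  have hpos : 0 < ∏ i ∈ Finset.range u, (p ^ (i + 1) - 1) := Finset.prod_pos fun i _ => by
    have := Nat.one_lt_pow i.succ_ne_zero hp.one_lt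
    lia
  have hle := Nat.le_of_dvd hpos hdvd
  have hlt : w < ∑ i ∈ Finset.range u, (i + 1) := by
    refine (Nat.pow_lt_pow_iff_right hp.one_lt).1 ?_
    exact ((Nat.pow_le_pow_left hf.le w).trans hle).trans_lt
      (Nat.prod_range_pow_sub_one_lt hp.one_lt hu)
  have hT : (∑ i ∈ Finset.range u, (i + 1)) * 2 = u * (u + 1) := by
    have := Finset.sum_range_id_mul_two (u + 1)
    rw [Finset.sum_range_succ'] at this
    simpa [mul_comm] using this
  have hw : (2 * w) ^ 2 < (u * (u + 1)) ^ 2 := Nat.pow_lt_pow_left (by lia) two_ne_zero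
  have hlarge : 4 * p ^ u < (u * (u + 1)) ^ 2 := by nlinarith
  rcases Nat.lt_or_ge p 5 with hp5 | hp5
  swap
  · have h1 := Nat.sq_sum_range_lt_five_pow u
    have h2 := Nat.pow_le_pow_left hp5 u
    lia
  have hcases : p = 2 ∨ p = 3 := by
    interval_cases p
    all_goals first | (norm_num at hp; done) | simp
  have hred : ∀ w₀, w₀ ≤ w → f ^ w₀ ∣ ∏ i ∈ Finset.range u, (p ^ (i + 1) - 1) := fun w₀ h₀ =>
    (pow_dvd_pow f h₀).trans hdvd
  have hred' : ∀ w₀ g, w₀ ≤ w → g ≤ f → g ^ w₀ ≤ ∏ i ∈ Finset.range u, (p ^ (i + 1) - 1) :=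
    fun w₀ g h₀ hg => (Nat.pow_le_pow_left hg w₀).trans (Nat.le_of_dvd hpos (hred w₀ h₀))
  rcases hcases with rfl | rfl
  · have hu14 : u < 14 := by
      by_contra! h
      have := Nat.sq_sum_range_lt_two_pow h
      lia
    have hw' : ∀ w₀, w₀ ^ 2 < 2 ^ u → w₀ + 1 ≤ w := fun w₀ h₀ =>
      lt_of_pow_lt_pow_left₀ 2 w.zero_le (h₀.trans_le huw)
    have hf4 : f ≠ 4 := by rintro rfl; norm_num at hfp
    have hf6 : f ≠ 6 := by rintro rfl; norm_num at hfp
    have key : ∀ w₀, w₀ ^ 2 < 2 ^ u → ∏ i ∈ Finset.range u, (2 ^ (i + 1) - 1) < 7 ^ (w₀ + 1) →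
        ¬ 3 ^ (w₀ + 1) ∣ ∏ i ∈ Finset.range u, (2 ^ (i + 1) - 1) →
        ¬ 5 ^ (w₀ + 1) ∣ ∏ i ∈ Finset.range u, (2 ^ (i + 1) - 1) → False := by
      intro w₀ h₀ h7 h3 h5
      have hf7 : f < 7 := by
        by_contra! h
        exact (hred' _ 7 (hw' w₀ h₀) h).not_gt h7
      have h := hred _ (hw' w₀ h₀)
      interval_cases f <;> simp_all
    interval_cases u
    · lia
    · exact key 1 (by norm_num) (by decide) (by decide) (by decide)
    · exact key 2 (by norm_num) (by decide) (by decide) (by decide)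
    · exact key 3 (by norm_num) (by decide) (by decide) (by decide)
    · exact key 5 (by norm_num) (by decide) (by decide) (by decide)
    · exact key 7 (by norm_num) (by decide) (by decide) (by decide)
    · exact key 11 (by norm_num) (by decide) (by decide) (by decide)
    · exact key 15 (by norm_num) (by decide) (by decide) (by decide)
    · exact key 22 (by norm_num) (by decide) (by decide) (by decide)
    · exact key 31 (by norm_num) (by decide) (by decide) (by decide)
    · exact key 45 (by norm_num) (by decide) (by decide) (by decide)
    · exact key 63 (by norm_num) (by decide) (by decide) (by decide)
    · exact key 90 (by norm_num) (by decide) (by decide) (by decide)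
  · have hu5 : u < 5 := by
      by_contra! h
      have := Nat.sq_sum_range_lt_three_pow h
      lia
    interval_cases u
    · lia
    · lia
    · have : w ≤ 5 := by simp [Finset.sum_range_succ] at hlt; lia
      interval_cases w <;> lia
    · have := hred' 9 4 (by by_contra! h; interval_cases w <;> lia) (by lia)
      simp [Finset.prod_range_succ] at this

theorem IsSimpleGroup.map_eq_one_of_comm {G H : Type*} [Group G] [IsSimpleGroup G] [Group H]
    (hG : ¬ Group.IsSolvable G) (f : G →* H) (hf : ∀ a b, f a * f b = f b * f a) (g : G) :
    f g = 1 := by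
  rcases f.normal_ker.eq_bot_or_eq_top with h | h
  · refine absurd (Group.isSolvable_of_comm fun a b => ?_) hG
    refine (f.ker_eq_bot_iff.1 h) ?_
    rw [map_mul, map_mul, hf]
  · rw [← MonoidHom.mem_ker, h]
    exact Subgroup.mem_top g

/-- The idempotents of a reduced Artinian ring acting faithfully on a finite-dimensional space
split that space into at least as many nonzero summands as there are maximal ideals. -/
theorem MaximalSpectrum.card_le_finrank {K W R : Type*} [Field K] [AddCommGroup W] [Module K W]
    [Module.Finite K W] [CommRing R] [IsArtinianRing R] [IsReduced R] (ι : R →+* Module.End K W)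
    (hι : Function.Injective ι) : Nat.card (MaximalSpectrum R) ≤ Module.finrank K W := by
  classical
  have := Fintype.ofFinite (MaximalSpectrum R)
  let e : MaximalSpectrum R → R := fun m => (IsArtinianRing.equivPi R).symm (Pi.single m 1)
  have he : ∀ m, e m ≠ 0 := fun m h => by
    have := Ideal.Quotient.nontrivial_iff.2 m.isMaximal.ne_top
    simp [e] at h
  have hmul : ∀ m m', m ≠ m' → e m * e m' = 0 := fun m m' h => by
    simp only [e]
    rw [← map_mul, ← Pi.single_mul_left]
    simp [h]
  have hidem : ∀ m, e m * e m = e m := fun m => by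
    simp only [e]
    rw [← map_mul, ← Pi.single_mul, mul_one]
  have hw : ∀ m, ∃ w : W, ι (e m) w ≠ 0 := fun m => by
    by_contra! h
    exact he m (hι (by rw [map_zero]; exact LinearMap.ext h))
  choose w hw using hw
  have hli : LinearIndependent K fun m => ι (e m) (w m) := by
    rw [Fintype.linearIndependent_iff]
    intro c hc m
    have h := congrArg (ι (e m)) hc
    rw [map_zero, map_sum, Finset.sum_eq_single m] at h
    · rw [map_smul, ← Module.End.mul_apply, ← map_mul, hidem] at h
      exact (smul_eq_zero.1 h).resolve_right (hw m)
    · intro m' _ hne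
      rw [map_smul, ← Module.End.mul_apply, ← map_mul, hmul _ _ hne.symm]
      simp
    · simp
  rw [Nat.card_eq_fintype_card]
  exact hli.fintype_card_le_finrank

/-- Automorphisms of a finite commutative ring commute modulo a maximal ideal that they preserve. -/
theorem Ideal.IsMaximal.ringEquiv_comm_sub_mem {R : Type*} [CommRing R] [Finite R] {m : Ideal R}
    (hm : m.IsMaximal) (s t : R ≃+* R) (hs : ∀ r, s r ∈ m ↔ r ∈ m) (ht : ∀ r, t r ∈ m ↔ r ∈ m)
    (y : R) : s (t y) - t (s y) ∈ m := by
  by_cases hy : y ∈ m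
  · exact m.sub_mem ((hs _).2 ((ht _).2 hy)) ((ht _).2 ((hs _).2 hy))
  let := Ideal.Quotient.field m
  have : Finite (R ⧸ m) := Finite.of_surjective _ Ideal.Quotient.mk_surjective
  obtain ⟨u, hu⟩ := IsCyclic.exists_generator (α := (R ⧸ m)ˣ)
  obtain ⟨x, hx⟩ := Ideal.Quotient.mk_surjective (u : R ⧸ m)
  have key : ∀ z, z ∉ m → ∃ k : ℕ, z - x ^ k ∈ m := fun z hz => by
    have hz0 : Ideal.Quotient.mk m z ≠ 0 := fun h => hz (Ideal.Quotient.eq_zero_iff_mem.1 h)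
    obtain ⟨k, hk⟩ := (mem_powers_iff_mem_zpowers).2 (hu (Units.mk0 _ hz0))
    refine ⟨k, ?_⟩
    rw [← Ideal.Quotient.eq, map_pow, hx, ← Units.val_pow_eq_pow_val]
    exact (congrArg Units.val hk).symm
  have hxm : x ∉ m := fun h => by
    rw [← Ideal.Quotient.eq_zero_iff_mem, hx] at h
    exact u.ne_zero h
  obtain ⟨a, ha⟩ := key (s x) (by rwa [hs])
  obtain ⟨b, hb⟩ := key (t x) (by rwa [ht])
  obtain ⟨c, hc⟩ := key y hy
  have hpow : ∀ v w : R, v - w ∈ m → ∀ k : ℕ, v ^ k - w ^ k ∈ m := fun v w h k => by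
    rw [← Ideal.Quotient.eq] at h ⊢
    rw [map_pow, map_pow, h]
  have hst : ∀ (s t : R ≃+* R), (∀ r, s r ∈ m ↔ r ∈ m) → (∀ r, t r ∈ m ↔ r ∈ m) → ∀ a b : ℕ,
      s x - x ^ a ∈ m → t x - x ^ b ∈ m → s (t y) - x ^ (a * b * c) ∈ m :=
    fun s t hs ht a b ha hb => by
      have h1 : s (t y) - s (t x) ^ c ∈ m := by
        have := (hs _).2 ((ht _).2 hc)
        simpa using this
      have h2 : s (t x) - s x ^ b ∈ m := by
        have := (hs _).2 hb
        simpa using this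
      have h3 := hpow _ _ h2 c
      have h4 := hpow _ _ (hpow _ _ ha b) c
      rw [← pow_mul, ← pow_mul] at h4
      have := m.add_mem (m.add_mem h1 h3) h4
      convert this using 1
      ring
  have h1 := hst s t hs ht a b ha hb
  have h2 := hst t s ht hs b a hb ha
  rw [mul_comm b a] at h2
  have := m.sub_mem h1 h2
  convert this using 1
  ring

/-- A finite insoluble simple group whose order is divisible by `q ^ dim W` acts trivially on every
finite reduced commutative ring that embeds in `End W`, where `W` is a space over `ZMod q`. -/
theorem IsSimpleGroup.ringEquiv_apply_eq_self {q : ℕ} [Fact q.Prime] {W R G : Type*}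
    [AddCommGroup W] [Module (ZMod q) W] [Module.Finite (ZMod q) W] [CommRing R] [Finite R]
    [IsReduced R] (ι : R →+* Module.End (ZMod q) W) (hι : Function.Injective ι) [Group G]
    [Finite G] [IsSimpleGroup G] (hG : ¬ Group.IsSolvable G)
    (hcard : q ^ Module.finrank (ZMod q) W ∣ Nat.card G) (τ : G →* (R ≃+* R)) (g : G) (r : R) :
    τ g r = r := by
  classical
  have hd := MaximalSpectrum.card_le_finrank ι hι
  let act : MulAction G (MaximalSpectrum R) :=
    { smul := fun g m => ⟨m.asIdeal.comap (τ g⁻¹),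
        have := m.isMaximal
        Ideal.comap_isMaximal_of_equiv _⟩
      one_smul := fun m => by
        refine MaximalSpectrum.ext (Ideal.ext fun r => ?_)
        change τ 1⁻¹ r ∈ m.asIdeal ↔ _
        simp
      mul_smul := fun a b m => by
        refine MaximalSpectrum.ext (Ideal.ext fun r => ?_)
        change τ (a * b)⁻¹ r ∈ m.asIdeal ↔ τ b⁻¹ (τ a⁻¹ r) ∈ m.asIdeal
        rw [mul_inv_rev, map_mul, RingAut.mul_apply] }
  let φ := MulAction.toPermHom G (MaximalSpectrum R)
  have hφ : φ.ker = ⊤ := by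
    refine (φ.normal_ker.eq_bot_or_eq_top).resolve_left fun h => ?_
    have := Fintype.ofFinite (MaximalSpectrum R)
    have h1 : Nat.card G ∣ (Nat.card (MaximalSpectrum R)).factorial := by
      rw [← Nat.card_perm]
      exact Subgroup.card_dvd_of_injective φ (φ.ker_eq_bot_iff.1 h)
    rcases Nat.eq_zero_or_pos (Nat.card (MaximalSpectrum R)) with h0 | h0
    · rw [h0, Nat.factorial_zero, Nat.dvd_one] at h1
      exact (Finite.one_lt_card (α := G)).ne' h1
    have h2 := (padicValNat_dvd_iff_le (Nat.factorial_ne_zero _)).1 (hcard.trans h1)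
    have h3 := padicValNat_factorial_lt_of_ne_zero q h0.ne'
    lia
  have hmem : ∀ (g : G) (m : MaximalSpectrum R) (r : R), τ g r ∈ m.asIdeal ↔ r ∈ m.asIdeal := by
    intro g m r
    have h : φ g⁻¹ = 1 := by
      rw [← MonoidHom.mem_ker, hφ]
      exact Subgroup.mem_top _
    have h1 : φ g⁻¹ m = m := by
      rw [h]
      rfl
    have h2 : m.asIdeal.comap (τ g⁻¹⁻¹) = m.asIdeal := congrArg MaximalSpectrum.asIdeal h1
    rw [inv_inv] at h2
    conv_rhs => rw [← h2]
    rfl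
  have hcomm : ∀ a b, τ a * τ b = τ b * τ a := fun a b => by
    refine RingEquiv.ext fun y => (IsArtinianRing.equivPi R).injective (funext fun m => ?_)
    rw [IsArtinianRing.equivPi_apply, IsArtinianRing.equivPi_apply]
    exact Ideal.Quotient.eq.2
      (m.isMaximal.ringEquiv_comm_sub_mem (τ a) (τ b) (hmem a m) (hmem b m) y)
  rw [IsSimpleGroup.map_eq_one_of_comm hG τ hcomm g]
  rfl

/-- Conjugation by a unit normalizing `S` preserves the subalgebra generated by `S`. -/
theorem Algebra.conj_mem_adjoin {K E : Type*} [CommRing K] [Ring E] [Algebra K E] {S : Set E}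
    (u : Eˣ) (hu : ∀ s ∈ S, u * s * u⁻¹ ∈ S) {r : E} (hr : r ∈ Algebra.adjoin K S) :
    u * r * u⁻¹ ∈ Algebra.adjoin K S := by
  induction hr using Algebra.adjoin_induction with
  | mem x hx => exact Algebra.subset_adjoin (hu x hx)
  | algebraMap k =>
    rw [← Algebra.commutes, mul_assoc, Units.mul_inv, mul_one]
    exact Subalgebra.algebraMap_mem _ k
  | add x y _ _ hx hy =>
    rw [mul_add, add_mul]
    exact add_mem hx hy
  | mul x y _ _ hx hy =>
    have := mul_mem hx hy
    convert this using 1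
    simp [mul_assoc]

/-- A commutative subring of `End W` normalized by an irreducible linear group is reduced. -/
theorem Module.End.isReduced_of_irreducible {K W R : Type*} [Field K] [AddCommGroup W]
    [Module K W] [Nontrivial W] [CommRing R] [IsNoetherianRing R] (ι : R →+* Module.End K W)
    (hι : Function.Injective ι) (Γ : Subgroup (Module.End K W)ˣ)
    (hirr : ∀ S : Submodule K W, (∀ γ ∈ Γ, ∀ w ∈ S, γ.1 w ∈ S) → S = ⊥ ∨ S = ⊤)
    (hΓ : ∀ γ ∈ Γ, ∀ r, ∃ r', ι r' = γ.1 * ι r * (γ⁻¹).1) : IsReduced R := by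
  rw [← nilradical_eq_bot_iff]
  let T : Submodule K W := ⨅ j ∈ nilradical R, LinearMap.ker (ι j)
  have hT : ∀ w, w ∈ T ↔ ∀ j ∈ nilradical R, ι j w = 0 := fun w => by simp [T]
  have htop : T = ⊤ := by
    refine (hirr T fun γ hγ w hw => ?_).resolve_left fun hbot => ?_
    · rw [hT] at hw ⊢
      intro j hj
      obtain ⟨j', hj'⟩ := hΓ γ⁻¹ (inv_mem hγ) j
      have hn : j' ∈ nilradical R := by
        rw [mem_nilradical] at hj ⊢
        obtain ⟨k, hk⟩ := hj
        refine ⟨k, hι ?_⟩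
        rw [map_pow, hj', inv_inv, Units.conj_pow', ← map_pow, hk]
        simp
      have := hw j' hn
      rw [hj', inv_inv] at this
      have h2 : γ.1 ((γ⁻¹).1 (ι j (γ.1 w))) = γ.1 0 := congrArg _ this
      rw [← Module.End.mul_apply, Units.mul_inv, map_zero] at h2
      exact h2
    · have hex : ∃ k, nilradical R ^ k = ⊥ := IsNoetherianRing.isNilpotent_nilradical R
      classical
      have hk := Nat.find_spec hex
      have hk0 : Nat.find hex ≠ 0 := fun h => by
        rw [h, pow_zero, Ideal.one_eq_top] at hk
        have h1 : (1 : R) = 0 := by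
          rw [← Ideal.mem_bot, ← hk]
          exact Submodule.mem_top
        obtain ⟨w, hw⟩ := exists_ne (0 : W)
        apply hw
        have := congrArg (fun r => ι r w) h1
        simpa using this
      obtain ⟨k, hkk⟩ := Nat.exists_eq_succ_of_ne_zero hk0
      have hlt := Nat.find_min hex (m := k) (by lia)
      rw [hkk, pow_succ] at hk
      obtain ⟨x, hx, hx0⟩ := Submodule.exists_mem_ne_zero_of_ne_bot hlt
      apply hx0
      refine hι (LinearMap.ext fun w => ?_)
      rw [map_zero]
      change ι x w = 0
      rw [← Submodule.mem_bot K, ← hbot, hT]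
      intro j hj
      have : x * j = 0 := by
        rw [← Ideal.mem_bot, ← hk]
        exact Ideal.mul_mem_mul hx hj
      rw [← Module.End.mul_apply, ← map_mul, mul_comm, this]
      simp
  rw [eq_bot_iff]
  intro j hj
  rw [Ideal.mem_bot]
  refine hι (LinearMap.ext fun w => ?_)
  have : w ∈ T := htop ▸ Submodule.mem_top
  rw [map_zero]
  exact (hT w).1 this j hj

/-- An abelian group `B` normalized by an irreducible linear group `Γ` is centralized by the
insoluble finite simple groups in `Γ` of sufficiently divisible order. -/
theorem IsSimpleGroup.commute_of_irreducible {q : ℕ} [Fact q.Prime] {W G : Type*}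
    [AddCommGroup W] [Module (ZMod q) W] [Finite W] [Nontrivial W] [Group G]
    [Finite G] [IsSimpleGroup G] (hG : ¬ Group.IsSolvable G)
    (hcard : q ^ Module.finrank (ZMod q) W ∣ Nat.card G)
    (σ : G →* (Module.End (ZMod q) W)ˣ) (Γ B : Subgroup (Module.End (ZMod q) W)ˣ)
    (hirr : ∀ S : Submodule (ZMod q) W, (∀ γ ∈ Γ, ∀ w ∈ S, γ.1 w ∈ S) → S = ⊥ ∨ S = ⊤)
    (hσ : ∀ g, σ g ∈ Γ) (hΓ : ∀ γ ∈ Γ, ∀ b ∈ B, γ * b * γ⁻¹ ∈ B)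
    (hB : ∀ a ∈ B, ∀ b ∈ B, a * b = b * a) (g : G) {b : (Module.End (ZMod q) W)ˣ} (hb : b ∈ B) :
    Commute (σ g) b := by
  have : Module.Finite (ZMod q) W := Module.Finite.of_finite
  have : Finite (Module.End (ZMod q) W) := DFunLike.finite _
  let S : Set (Module.End (ZMod q) W) := (fun u : (Module.End (ZMod q) W)ˣ => u.1) '' B
  have hS : ∀ γ ∈ Γ, ∀ s ∈ S, γ.1 * s * (γ⁻¹).1 ∈ S := by
    rintro γ hγ _ ⟨b, hb, rfl⟩
    exact ⟨_, hΓ γ hγ b hb, rfl⟩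
  let := Algebra.adjoinCommRingOfComm (ZMod q) (s := S) (by
    rintro _ ⟨a, ha, rfl⟩ _ ⟨b, hb, rfl⟩
    exact congrArg Units.val (hB a ha b hb))
  let ι : Algebra.adjoin (ZMod q) S →+* Module.End (ZMod q) W :=
    (Algebra.adjoin (ZMod q) S).subtype
  have hι : Function.Injective ι := Subtype.val_injective
  have hred : IsReduced (Algebra.adjoin (ZMod q) S) :=
    Module.End.isReduced_of_irreducible ι hι Γ hirr fun γ hγ r =>
      ⟨⟨_, Algebra.conj_mem_adjoin γ (hS γ hγ) r.2⟩, rfl⟩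
  let t : G → Algebra.adjoin (ZMod q) S → Algebra.adjoin (ZMod q) S := fun g r =>
    ⟨_, Algebra.conj_mem_adjoin (σ g) (hS _ (hσ g)) r.2⟩
  have ht : ∀ g r, (t g r).1 = (σ g).1 * r.1 * ((σ g)⁻¹).1 := fun g r => rfl
  have ht_mul : ∀ a b r, t a (t b r) = t (a * b) r := fun a b r => Subtype.ext (by
    rw [ht, ht, ht, map_mul, mul_inv_rev, Units.val_mul, Units.val_mul]
    simp only [mul_assoc])
  have ht_one : ∀ r, t 1 r = r := fun r => Subtype.ext (by
    rw [ht, map_one]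
    simp)
  let τ : G →* (Algebra.adjoin (ZMod q) S ≃+* Algebra.adjoin (ZMod q) S) :=
    { toFun := fun g =>
        { toFun := t g
          invFun := t g⁻¹
          left_inv := fun r => by rw [ht_mul, inv_mul_cancel, ht_one]
          right_inv := fun r => by rw [ht_mul, mul_inv_cancel, ht_one]
          map_mul' := fun x y => Subtype.ext (by
            change _ = (t g x).1 * (t g y).1
            rw [ht, ht, ht]
            change (σ g).1 * (x.1 * y.1) * ((σ g)⁻¹).1 = _
            simp [mul_assoc])
          map_add' := fun x y => Subtype.ext (by
            change _ = (t g x).1 + (t g y).1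
            rw [ht, ht, ht]
            change (σ g).1 * (x.1 + y.1) * ((σ g)⁻¹).1 = _
            rw [mul_add, add_mul]) }
      map_one' := RingEquiv.ext ht_one
      map_mul' := fun a b => RingEquiv.ext fun r => (ht_mul a b r).symm }
  have h := congrArg Subtype.val (IsSimpleGroup.ringEquiv_apply_eq_self ι hι hG hcard τ g
    ⟨b.1, Algebra.subset_adjoin ⟨b, hb, rfl⟩⟩)
  have h' : σ g * b * (σ g)⁻¹ = b := Units.ext h
  exact mul_inv_eq_iff_eq_mul.1 h'

/-- In a faithful linear representation of a group of class two whose centre acts by scalars, coset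
representatives of the centre act linearly independently. -/
theorem Subgroup.index_center_le_finrank_sq {F W E : Type*} [Field F] [AddCommGroup W] [Module F W]
    [Module.Finite F W] [Nontrivial W] [Group E] [Finite E] (ρ : E →* Module.End F W)
    (hρ : Function.Injective ρ) (hz : ∀ z ∈ Subgroup.center E, ∃ c : F, ρ z = c • 1)
    (hE : ∀ x y : E, x * y * x⁻¹ * y⁻¹ ∈ Subgroup.center E) :
    (Subgroup.center E).index ≤ Module.finrank F W ^ 2 := by
  classical
  choose c hc using fun x e : E => hz _ (hE x e)
  have hone : (1 : Module.End F W) ≠ 0 := one_ne_zero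
  have hinj : ∀ a b : F, a • (1 : Module.End F W) = b • 1 → a = b := fun a b h =>
    smul_left_injective F hone h
  have hconj : ∀ x e, ρ x * ρ e = c x e • (ρ e * ρ x) := fun x e => by
    rw [← map_mul, ← map_mul, ← one_mul (ρ (e * x)), ← smul_mul_assoc, ← hc, ← map_mul]
    congr 1
    group
  have hunit : ∀ e, ρ e * ρ e⁻¹ = 1 := fun e => by rw [← map_mul, mul_inv_cancel, map_one]
  let χ : E → E →* F := fun e =>
    { toFun := fun x => c x e
      map_one' := hinj _ _ (by rw [← hc]; simp)
      map_mul' := fun x y => hinj _ _ (by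
        have h1 : ρ (x * y) * ρ e = (c x e * c y e) • (ρ e * ρ (x * y)) := by
          rw [map_mul, mul_assoc, hconj y e, mul_smul_comm, ← mul_assoc, hconj x e,
            smul_mul_assoc, smul_smul, mul_assoc, mul_comm (c y e)]
        have h2 := congrArg (fun m => m * ρ (e * (x * y))⁻¹) ((hconj (x * y) e).symm.trans h1)
        simp only [smul_mul_assoc] at h2
        rw [← map_mul, hunit] at h2
        exact h2) }
  have hχ : ∀ e e', χ e = χ e' → e⁻¹ * e' ∈ Subgroup.center E := fun e e' h => by
    rw [Subgroup.mem_center_iff]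
    intro x
    have hx : c x e = c x e' := DFunLike.congr_fun h x
    have h1 : x * e * x⁻¹ * e⁻¹ = x * e' * x⁻¹ * e'⁻¹ := hρ (by rw [hc, hc, hx])
    have h4 : x * e' = x * e * x⁻¹ * e⁻¹ * e' * x := by rw [h1]; group
    have h6 : x * e⁻¹ = e⁻¹ * (x * e * x⁻¹ * e⁻¹)⁻¹ * x := by
      group
    calc x * (e⁻¹ * e') = x * e⁻¹ * e' := by group
      _ = e⁻¹ * (x * e * x⁻¹ * e⁻¹)⁻¹ * (x * e') := by rw [h6]; group
      _ = e⁻¹ * e' * x := by rw [h4]; group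
  let r : E ⧸ Subgroup.center E → E := Quotient.out
  have hr : Function.Injective fun i => χ (r i) := fun i j h => by
    have := hχ _ _ h
    rw [← QuotientGroup.eq] at this
    simpa [r] using this
  have := Fintype.ofFinite (E ⧸ Subgroup.center E)
  have hli : LinearIndependent F fun i => ρ (r i) := by
    rw [Fintype.linearIndependent_iff]
    intro a ha i
    have hsum : ∀ x, ∑ i, (a i * χ (r i) x) • ρ (r i) = 0 := fun x => by
      have h1 : ρ x * (∑ i, a i • ρ (r i)) * ρ x⁻¹ = 0 := by rw [ha]; simp
      rw [Finset.mul_sum, Finset.sum_mul] at h1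
      rw [← h1]
      refine Finset.sum_congr rfl fun i _ => ?_
      rw [mul_smul_comm, hconj, smul_smul, smul_mul_assoc, mul_assoc, hunit, mul_one]
      rfl
    have hzero : a i • ρ (r i) = 0 := by
      rw [← Module.forall_dual_apply_eq_zero_iff F]
      intro ℓ
      have h1 := (Fintype.linearIndependent_iff.1
        ((linearIndependent_monoidHom E F).comp _ hr)) (fun i => a i * ℓ (ρ (r i))) (by
          funext x
          have := congrArg ℓ (hsum x)
          rw [map_sum, map_zero] at this
          rw [Finset.sum_apply, Pi.zero_apply, ← this]
          refine Finset.sum_congr rfl fun i _ => ?_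
          rw [map_smul]
          simp only [Function.comp_apply, Pi.smul_apply, smul_eq_mul]
          ring) i
      rwa [map_smul]
    refine (smul_eq_zero.1 hzero).resolve_right fun h => ?_
    have := hunit (r i)
    rw [h, zero_mul] at this
    exact hone this.symm
  rw [Subgroup.index, Nat.card_eq_fintype_card, sq]
  have := hli.fintype_card_le_finrank
  rwa [Module.finrank_linearMap] at this

/-- The commutant of an irreducible linear group is a domain. -/
theorem Module.End.isDomain_centralizer_of_irreducible {K W : Type*} [Field K] [AddCommGroup W]
    [Module K W] [Module.Finite K W] [Nontrivial W] (Γ : Subgroup (Module.End K W)ˣ)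
    (hirr : ∀ S : Submodule K W, (∀ γ ∈ Γ, ∀ w ∈ S, γ.1 w ∈ S) → S = ⊥ ∨ S = ⊤) :
    IsDomain (Subalgebra.centralizer K ((fun u : (Module.End K W)ˣ => u.1) '' Γ)) := by
  have hinj : ∀ a ∈ Subalgebra.centralizer K ((fun u : (Module.End K W)ˣ => u.1) '' Γ), a ≠ 0 →
      ∀ w, a w = 0 → w = 0 := fun a ha ha0 w hw => by
    have h := (hirr (LinearMap.ker a) fun γ hγ w hw => ?_).resolve_right fun h => ha0 (by
      rwa [LinearMap.ker_eq_top] at h)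
    · rw [← Submodule.mem_bot K, ← h]
      exact hw
    · have h1 := (Subalgebra.mem_centralizer_iff K).1 ha γ.1 ⟨γ, hγ, rfl⟩
      rw [LinearMap.mem_ker, ← Module.End.mul_apply, ← h1, Module.End.mul_apply,
        LinearMap.mem_ker.1 hw, map_zero]
  have : NoZeroDivisors (Subalgebra.centralizer K ((fun u : (Module.End K W)ˣ => u.1) '' Γ)) :=
    ⟨fun {a b} hab => or_iff_not_imp_left.2 fun ha => Subtype.ext (LinearMap.ext fun w =>
      hinj a.1 a.2 (fun h => ha (Subtype.ext h)) _ (by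
        have := congrArg (fun m => m.1 w) hab
        exact this))⟩
  exact NoZeroDivisors.to_isDomain _

/-- Numerical constraints imposed by a normal subgroup of class two in an irreducible linear
group, where `f` is the order of the commutant of the irreducible group. -/
theorem Subgroup.exists_card_eq_pow_of_irreducible {q : ℕ} [Fact q.Prime] {W : Type*}
    [AddCommGroup W] [Module (ZMod q) W] [Finite W] [Nontrivial W]
    (Γ E : Subgroup (Module.End (ZMod q) W)ˣ)
    (hirr : ∀ S : Submodule (ZMod q) W, (∀ γ ∈ Γ, ∀ w ∈ S, γ.1 w ∈ S) → S = ⊥ ∨ S = ⊤)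
    (hEΓ : E ≤ Γ) (hz : ∀ z ∈ Subgroup.center E, ∀ γ ∈ Γ, γ * z = z * γ)
    (hE : ∀ x y : E, x * y * x⁻¹ * y⁻¹ ∈ Subgroup.center E) {p : ℕ} (hp : p.Prime)
    (hpow : ∀ x : E, x ^ p ∈ Subgroup.center E) (htop : Subgroup.center E ≠ ⊤) :
    ∃ f w : ℕ, p < f ∧ f.Coprime p ∧ q ^ Module.finrank (ZMod q) W = f ^ w ∧
      (Subgroup.center E).index ≤ w ^ 2 := by
  classical
  have : Module.Finite (ZMod q) W := Module.Finite.of_finite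
  have : Finite (Module.End (ZMod q) W) := DFunLike.finite _
  have hdom := Module.End.isDomain_centralizer_of_irreducible Γ hirr
  let F := Subalgebra.centralizer (ZMod q) ((fun u : (Module.End (ZMod q) W)ˣ => u.1) '' Γ)
  have : Finite F := Subtype.finite
  have := Fintype.ofFinite F
  let : DivisionRing F := Fintype.divisionRingOfIsDomain F
  let : Field F := littleWedderburn F
  have : Module.Finite F W := Module.Finite.of_finite
  have hsmul : ∀ (a : F) (w : W), a • w = a.1 w := fun a w => rfl
  let ρ : E →* Module.End F W :=
    { toFun := fun e =>
        { toFun := e.1.1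
          map_add' := map_add _
          map_smul' := fun a w => by
            have h1 := (Subalgebra.mem_centralizer_iff (ZMod q)).1 a.2 e.1.1 ⟨e.1, hEΓ e.2, rfl⟩
            exact congrArg (fun m => m w) h1 }
      map_one' := rfl
      map_mul' := fun a b => rfl }
  have hρ : Function.Injective ρ := fun a b h => Subtype.ext (Units.ext (LinearMap.ext fun w =>
    congrArg (fun m => m w) h))
  have hzF : ∀ z ∈ Subgroup.center E, z.1.1 ∈ F := fun z h => by
    rw [Subalgebra.mem_centralizer_iff]
    rintro _ ⟨γ, hγ, rfl⟩
    exact congrArg Units.val (hz z h γ hγ)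
  have hindex := Subgroup.index_center_le_finrank_sq ρ hρ
    (fun z h => ⟨⟨z.1.1, hzF z h⟩, rfl⟩) hE
  have hcard : Nat.card W = Nat.card F ^ Module.finrank F W := Module.natCard_eq_pow_finrank
  have hcard' : Nat.card W = q ^ Module.finrank (ZMod q) W := by
    rw [Module.natCard_eq_pow_finrank (K := ZMod q), Nat.card_zmod]
  obtain ⟨x, y, hxy⟩ : ∃ x y : E, x * y * x⁻¹ * y⁻¹ ≠ 1 := by
    by_contra! h
    refine htop (eq_top_iff.2 fun x _ => Subgroup.mem_center_iff.2 fun y => ?_)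
    have := h x y
    rw [mul_inv_eq_one, mul_inv_eq_iff_eq_mul] at this
    exact this.symm
  set c := x * y * x⁻¹ * y⁻¹ with hc
  have hcc := Subgroup.mem_center_iff.1 (hE x y)
  rw [← hc] at hcc
  have hpow1 : ∀ k : ℕ, x ^ k * y * (x ^ k)⁻¹ * y⁻¹ = c ^ k := fun k => by
    induction k with
    | zero => simp
    | succ k ih =>
      calc x ^ (k + 1) * y * (x ^ (k + 1))⁻¹ * y⁻¹
          = x * (x ^ k * y * (x ^ k)⁻¹ * y⁻¹) * y * x⁻¹ * y⁻¹ := by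
            rw [pow_succ' x]; group
        _ = (x * c ^ k) * y * x⁻¹ * y⁻¹ := by rw [ih]
        _ = (c ^ k * x) * y * x⁻¹ * y⁻¹ := by
            rw [Commute.pow_right (show Commute x c from hcc x) k]
        _ = c ^ k * c := by rw [hc]; group
        _ = c ^ (k + 1) := (pow_succ _ _).symm
  have hcp : c ^ p = 1 := by
    rw [← hpow1, ← Subgroup.mem_center_iff.1 (hpow x) y]
    group
  let cF : F := ⟨c.1.1, hzF c (hE x y)⟩
  have hcF : cF ^ p = 1 := by
    have := congrArg (fun e : E => e.1.1) hcp
    exact Subtype.ext (by simpa using this)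
  have hcF1 : cF ≠ 1 := fun h => hxy (Subtype.ext (Units.ext (congrArg Subtype.val h)))
  have hcF0 : cF ≠ 0 := fun h => by
    rw [h, zero_pow hp.ne_zero] at hcF
    exact zero_ne_one hcF
  have hdvd : p ∣ Nat.card F - 1 := by
    have : Fact p.Prime := ⟨hp⟩
    have h1 : orderOf (Units.mk0 cF hcF0) = p :=
      orderOf_eq_prime (Units.ext hcF) fun h => hcF1 (congrArg Units.val h)
    rw [← Nat.card_units, ← h1]
    exact _root_.orderOf_dvd_natCard (Units.mk0 cF hcF0)
  have hF1 : 1 < Nat.card F := Finite.one_lt_card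
  have hle := Nat.le_of_dvd (by lia) hdvd
  refine ⟨Nat.card F, Module.finrank F W, by lia, ?_, hcard'.symm.trans hcard, hindex⟩
  rw [Nat.coprime_comm, hp.coprime_iff_not_dvd]
  intro h
  have := (Nat.dvd_sub_iff_right hF1.le h).1 hdvd
  exact hp.one_lt.ne' (Nat.dvd_one.1 this)

/-- A nontrivial finite solvable group has a nontrivial characteristic elementary abelian
subgroup. -/
theorem Group.exists_characteristic_elementary_abelian (Q : Type*) [Group Q] [Finite Q]
    [Nontrivial Q] (hQ : Group.IsSolvable Q) :
    ∃ p : ℕ, p.Prime ∧ ∃ V : Subgroup Q, V.Characteristic ∧ V ≠ ⊥ ∧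
      (∀ x ∈ V, ∀ y ∈ V, x * y = y * x) ∧ ∀ x ∈ V, x ^ p = 1 := by
  classical
  have hk := Nat.find_spec hQ.solvable
  have hk0 : Nat.find hQ.solvable ≠ 0 := fun h => by
    rw [h, derivedSeries_zero] at hk
    exact top_ne_bot hk
  obtain ⟨k, hkk⟩ := Nat.exists_eq_succ_of_ne_zero hk0
  have hlt := Nat.find_min hQ.solvable (m := k) (by lia)
  rw [hkk, derivedSeries_succ, Subgroup.commutator_eq_bot_iff_le_centralizer] at hk
  set D := derivedSeries Q k
  have hcomm : ∀ x ∈ D, ∀ y ∈ D, x * y = y * x := fun x hx y hy =>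
    (Subgroup.mem_centralizer_iff.1 (hk hy)) x hx
  have hcard : Nat.card D ≠ 1 := fun h => hlt (Subgroup.card_eq_one.1 h)
  obtain ⟨p, hp, hpD⟩ := Nat.exists_prime_and_dvd hcard
  have : Fact p.Prime := ⟨hp⟩
  obtain ⟨x, hx⟩ := exists_prime_orderOf_dvd_card' (G := D) p hpD
  let V : Subgroup Q :=
    { carrier := {x | x ∈ D ∧ x ^ p = 1}
      one_mem' := ⟨one_mem D, one_pow p⟩
      mul_mem' := fun {a b} ha hb => ⟨mul_mem ha.1 hb.1, by
        rw [Commute.mul_pow (hcomm a ha.1 b hb.1), ha.2, hb.2, one_mul]⟩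
      inv_mem' := fun {a} ha => ⟨inv_mem ha.1, by rw [inv_pow, ha.2, inv_one]⟩ }
  have hchar : V.Characteristic := by
    refine Subgroup.characteristic_iff_le_comap.2 fun φ x hx => ⟨?_, ?_⟩
    · exact Subgroup.characteristic_iff_le_comap.1 (derivedSeries_characteristic Q k) φ hx.1
    · rw [← map_pow, hx.2, map_one]
  refine ⟨p, hp, V, hchar, fun h => ?_,
    fun x hx y hy => hcomm x hx.1 y hy.1, fun x hx => hx.2⟩
  have hxV : (x : Q) ∈ V := ⟨x.2, by
    rw [← Subgroup.coe_pow, ← hx, pow_orderOf_eq_one, Subgroup.coe_one]⟩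
  rw [h, Subgroup.mem_bot] at hxV
  have : x = 1 := Subtype.ext hxV
  rw [this, orderOf_one] at hx
  exact hp.one_lt.ne hx

/-- Automorphisms of an elementary abelian group as linear maps over the prime field. -/
def MulAut.toZModUnits (p : ℕ) (V : Type*) [CommGroup V] [Module (ZMod p) (Additive V)] :
    MulAut V →* (Module.End (ZMod p) (Additive V))ˣ :=
  MonoidHom.toHomUnits
    { toFun := fun s => AddMonoidHom.toZModLinearMap p (MonoidHom.toAdditive s.toMonoidHom)
      map_one' := rfl
      map_mul' := fun _ _ => rfl }

theorem MulAut.toZModUnits_injective (p : ℕ) (V : Type*) [CommGroup V]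
    [Module (ZMod p) (Additive V)] : Function.Injective (MulAut.toZModUnits p V) :=
  fun s t h => MulEquiv.ext fun v => by
    have := congrArg (fun u => u.1 (Additive.ofMul v)) h
    exact this

/-- A group acting faithfully on an elementary abelian `p`-group of order `p ^ u` has order dividing
the order of `GL_u(p)`. -/
theorem MulAut.exists_card_dvd {p : ℕ} (hp : p.Prime) {G V : Type*} [Group G] [CommGroup V]
    [Finite V] (hV : ∀ v : V, v ^ p = 1) (ψ : G →* MulAut V) (hψ : Function.Injective ψ) :
    ∃ u, Nat.card V = p ^ u ∧ Nat.card G ∣ ∏ i ∈ Finset.range u, (p ^ u - p ^ i) := by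
  have : Fact p.Prime := ⟨hp⟩
  let : Module (ZMod p) (Additive V) := AddCommGroup.zmodModule (n := p) fun v => hV v.toMul
  have : Module.Finite (ZMod p) (Additive V) := Module.Finite.of_finite
  let b := Module.finBasis (ZMod p) (Additive V)
  refine ⟨Module.finrank (ZMod p) (Additive V), ?_, ?_⟩
  · rw [Nat.card_congr Additive.ofMul, Module.natCard_eq_pow_finrank (K := ZMod p), Nat.card_zmod]
  · have h1 : Nat.card (Module.End (ZMod p) (Additive V))ˣ =
        Nat.card (Matrix.GeneralLinearGroup (Fin (Module.finrank (ZMod p) (Additive V)))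
          (ZMod p)) :=
      Nat.card_congr (Units.mapEquiv (algEquivMatrix b).toMulEquiv).toEquiv
    rw [Matrix.card_GL_field, ZMod.card] at h1
    rw [Finset.prod_range, ← h1]
    refine Subgroup.card_dvd_of_injective ((MulAut.toZModUnits p V).comp ψ) ?_
    exact (MulAut.toZModUnits_injective p V).comp hψ

/-- Restriction of a group action by automorphisms to an invariant subgroup. -/
def MulAut.restrictHom {G N : Type*} [Group G] [Group N] (φ : G →* MulAut N) (K : Subgroup N)
    (hK : ∀ g, ∀ x ∈ K, φ g x ∈ K) : G →* MulAut K where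
  toFun g :=
    { toFun := fun x => ⟨φ g x, hK g x x.2⟩
      invFun := fun x => ⟨φ g⁻¹ x, hK g⁻¹ x x.2⟩
      left_inv := fun x => Subtype.ext (by
        change φ g⁻¹ (φ g x) = x
        rw [← MulAut.mul_apply, ← map_mul, inv_mul_cancel, map_one, MulAut.one_apply])
      right_inv := fun x => Subtype.ext (by
        change φ g (φ g⁻¹ x) = x
        rw [← MulAut.mul_apply, ← map_mul, mul_inv_cancel, map_one, MulAut.one_apply])
      map_mul' := fun x y => Subtype.ext (map_mul (φ g) x.1 y.1) }
  map_one' := MulEquiv.ext fun x => Subtype.ext (by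
    change φ 1 x = x
    rw [map_one, MulAut.one_apply])
  map_mul' a b := MulEquiv.ext fun x => Subtype.ext (by
    change φ (a * b) x = φ a (φ b x)
    rw [map_mul, MulAut.mul_apply])

/-- The action by automorphisms induced on the quotient by an invariant normal subgroup. -/
def MulAut.quotientHom {G N : Type*} [Group G] [Group N] (φ : G →* MulAut N) (K : Subgroup N)
    [K.Normal] (hK : ∀ g, ∀ x ∈ K, φ g x ∈ K) : G →* MulAut (N ⧸ K) where
  toFun g :=
    { toFun := QuotientGroup.map K K (φ g).toMonoidHom (hK g)
      invFun := QuotientGroup.map K K (φ g⁻¹).toMonoidHom (hK g⁻¹)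
      left_inv := fun x => by
        obtain ⟨x, rfl⟩ := QuotientGroup.mk_surjective x
        change ((φ g⁻¹ (φ g x) : N) : N ⧸ K) = x
        rw [← MulAut.mul_apply, ← map_mul, inv_mul_cancel, map_one, MulAut.one_apply]
      right_inv := fun x => by
        obtain ⟨x, rfl⟩ := QuotientGroup.mk_surjective x
        change ((φ g (φ g⁻¹ x) : N) : N ⧸ K) = x
        rw [← MulAut.mul_apply, ← map_mul, mul_inv_cancel, map_one, MulAut.one_apply]
      map_mul' := map_mul _ }
  map_one' := MulEquiv.ext fun x => by
    obtain ⟨x, rfl⟩ := QuotientGroup.mk_surjective x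
    change ((φ 1 x : N) : N ⧸ K) = x
    rw [map_one, MulAut.one_apply]
  map_mul' a b := MulEquiv.ext fun x => by
    obtain ⟨x, rfl⟩ := QuotientGroup.mk_surjective x
    change ((φ (a * b) x : N) : N ⧸ K) = (φ a (φ b x) : N)
    rw [map_mul, MulAut.mul_apply]

theorem Subgroup.Characteristic.apply_mem {N : Type*} [Group N] {K : Subgroup N}
    (hK : K.Characteristic) (φ : MulAut N) {x : N} (hx : x ∈ K) : φ x ∈ K :=
  Subgroup.characteristic_iff_le_comap.1 hK φ hx

/-- If `G` acts on `N` by automorphisms, nontrivially on every nontrivial quotient, then a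
normal subgroup of `N` fixed pointwise by `G` is central. -/
theorem Subgroup.le_center_of_fixed {G N : Type*} [Group G] [Group N] (φ : G →* MulAut N)
    (h1 : ∀ K : Subgroup N, K.Normal → (∀ g, ∀ x ∈ K, φ g x ∈ K) →
      (∀ g x, φ g x * x⁻¹ ∈ K) → K = ⊤)
    (B : Subgroup N) [hB : B.Normal] (hfix : ∀ g, ∀ b ∈ B, φ g b = b) :
    B ≤ Subgroup.center N := by
  have h := h1 (Subgroup.centralizer B) inferInstance (fun g x hx => ?_) fun g x => ?_
  · intro b hb
    rw [Subgroup.mem_center_iff]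
    intro x
    have hx : x ∈ Subgroup.centralizer (B : Set N) := h ▸ Subgroup.mem_top x
    exact ((Subgroup.mem_centralizer_iff.1 hx) b hb).symm
  · rw [Subgroup.mem_centralizer_iff] at hx ⊢
    intro b hb
    have := congrArg (φ g) (hx b hb)
    rwa [map_mul, map_mul, hfix g b hb] at this
  · rw [Subgroup.mem_centralizer_iff]
    intro b hb
    have hb' := hB.conj_mem b hb x⁻¹
    rw [inv_inv] at hb'
    have h2 := hfix g _ hb
    have h3 := hfix g _ hb'
    calc b * (φ g x * x⁻¹) = φ g b * φ g x * x⁻¹ := by rw [h2, mul_assoc]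
      _ = φ g (x * (x⁻¹ * b * x)) * x⁻¹ := by
        rw [← map_mul]
        congr 2
        group
      _ = φ g x * (x⁻¹ * b * x) * x⁻¹ := by rw [map_mul, h3]
      _ = φ g x * x⁻¹ * b := by group

/-- The structure of a solvable group acted on by an insoluble simple group that fixes its abelian
invariant normal subgroups. -/
theorem IsSimpleGroup.exists_class_two_subgroup {G N : Type*} [Group G] [Finite G]
    [IsSimpleGroup G] (hG : ¬ Group.IsSolvable G) [Group N] [Finite N] [Nontrivial N]
    (hN : Group.IsSolvable N) (φ : G →* MulAut N)
    (h1 : ∀ K : Subgroup N, K.Normal → (∀ g, ∀ x ∈ K, φ g x ∈ K) →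
      (∀ g x, φ g x * x⁻¹ ∈ K) → K = ⊤)
    (hA : ∀ B : Subgroup N, B.Normal → (∀ g, ∀ x ∈ B, φ g x ∈ B) →
      (∀ x ∈ B, ∀ y ∈ B, x * y = y * x) → ∀ g, ∀ b ∈ B, φ g b = b) :
    ∃ (p u : ℕ) (E : Subgroup N), p.Prime ∧ 0 < u ∧ (Subgroup.center E).index = p ^ u ∧
      (∀ z ∈ Subgroup.center E, (z : N) ∈ Subgroup.center N ∧ ∀ g, φ g z = z) ∧
      (∀ x y : E, x * y * x⁻¹ * y⁻¹ ∈ Subgroup.center E) ∧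
      (∀ x : E, x ^ p ∈ Subgroup.center E) ∧
      Nat.card G ∣ ∏ i ∈ Finset.range u, (p ^ u - p ^ i) := by
  have hclaim : ∀ B : Subgroup N, B.Normal → (∀ g, ∀ x ∈ B, φ g x ∈ B) →
      (∀ x ∈ B, ∀ y ∈ B, x * y = y * x) → B ≤ Subgroup.center N := fun B hB hBφ hBc =>
    Subgroup.le_center_of_fixed φ h1 B (hA B hB hBφ hBc)
  have hZφ : ∀ g, ∀ x ∈ Subgroup.center N, φ g x ∈ Subgroup.center N := fun g x hx =>
    Subgroup.centerCharacteristic.apply_mem (φ g) hx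
  have hZfix : ∀ g, ∀ x ∈ Subgroup.center N, φ g x = x :=
    hA _ inferInstance hZφ fun x _ y hy => Subgroup.mem_center_iff.1 hy x
  have hZtop : Subgroup.center N ≠ ⊤ := fun h => by
    have := h1 ⊥ inferInstance (fun g x hx => by
      rw [Subgroup.mem_bot] at hx ⊢
      rw [hx, map_one]) fun g x => by
        rw [Subgroup.mem_bot, mul_inv_eq_one]
        exact hZfix g x (h ▸ Subgroup.mem_top x)
    exact bot_ne_top this
  have : Nontrivial (N ⧸ Subgroup.center N) := QuotientGroup.nontrivial_iff.2 hZtop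
  obtain ⟨p, hp, V, hVchar, hVbot, hVcomm, hVp⟩ :=
    Group.exists_characteristic_elementary_abelian (N ⧸ Subgroup.center N) inferInstance
  let φQ := MulAut.quotientHom φ (Subgroup.center N) hZφ
  let E : Subgroup N := V.comap (QuotientGroup.mk' (Subgroup.center N))
  have hEn : E.Normal := inferInstance
  have hEφ : ∀ g, ∀ x ∈ E, φ g x ∈ E := fun g x hx => hVchar.apply_mem (φQ g) hx
  have hcenter : ∀ z : E, z ∈ Subgroup.center E ↔ (z : N) ∈ Subgroup.center N := fun z => by
    constructor
    · intro hz
      refine hclaim ((Subgroup.center E).map E.subtype) inferInstance ?_ ?_ ⟨z, hz, rfl⟩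
      · rintro g _ ⟨x, hx, rfl⟩
        exact ⟨_, Subgroup.centerCharacteristic.apply_mem (MulAut.restrictHom φ E hEφ g) hx, rfl⟩
      · rintro _ ⟨x, hx, rfl⟩ _ ⟨y, hy, rfl⟩
        exact congrArg Subtype.val (Subgroup.mem_center_iff.1 hy x)
    · intro hz
      rw [Subgroup.mem_center_iff] at hz ⊢
      exact fun x => Subtype.ext (hz x)
  let φV := MulAut.restrictHom φQ V fun g x hx => hVchar.apply_mem (φQ g) hx
  let : CommGroup V :=
    { (inferInstance : Group V) with
      mul_comm := fun x y => Subtype.ext (hVcomm x x.2 y y.2) }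
  have hφV : Function.Injective φV := by
    rw [← MonoidHom.ker_eq_bot_iff]
    refine (φV.normal_ker.eq_bot_or_eq_top).resolve_right fun h => hVbot ?_
    have htriv : ∀ g, ∀ e ∈ E, φ g e * e⁻¹ ∈ Subgroup.center N := fun g e he => by
      have h2 : φV g = 1 := by
        rw [← MonoidHom.mem_ker, h]
        exact Subgroup.mem_top g
      have h3 : ((φ g e : N) : N ⧸ Subgroup.center N) = e :=
        congrArg (fun s : MulAut V => (s ⟨e, he⟩).1) h2
      rw [← QuotientGroup.eq_one_iff, QuotientGroup.mk_mul, h3, QuotientGroup.mk_inv,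
        mul_inv_cancel]
    have hEfix : ∀ g, ∀ e ∈ E, φ g e = e := fun g e he => by
      let f : G →* Subgroup.center N :=
        { toFun := fun g => ⟨_, htriv g e he⟩
          map_one' := Subtype.ext (by simp)
          map_mul' := fun a b => Subtype.ext (by
            change φ (a * b) e * e⁻¹ = φ a e * e⁻¹ * (φ b e * e⁻¹)
            have h4 := hZfix a _ (htriv b e he)
            rw [map_mul, map_inv] at h4
            rw [map_mul, MulAut.mul_apply, Subgroup.mem_center_iff.1 (htriv b e he), ← h4]
            group) }
      have := congrArg Subtype.val (IsSimpleGroup.map_eq_one_of_comm hG f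
        (fun a b => Subtype.ext (Subgroup.mem_center_iff.1 (f b).2 (f a))) g)
      exact mul_inv_eq_one.1 this
    have hEZ := Subgroup.le_center_of_fixed φ h1 E hEfix
    rw [eq_bot_iff]
    intro v hv
    obtain ⟨x, rfl⟩ := QuotientGroup.mk_surjective v
    rw [Subgroup.mem_bot, QuotientGroup.eq_one_iff]
    exact hEZ hv
  obtain ⟨u, hu, hdvd⟩ := MulAut.exists_card_dvd hp (fun v : V => Subtype.ext (hVp v v.2)) φV hφV
  have hindex : (Subgroup.center E).index = Nat.card V := by
    have h2 : Subgroup.center E = (Subgroup.center N).subgroupOf E :=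
      Subgroup.ext fun z => hcenter z
    have h3 : V = E.map (QuotientGroup.mk' (Subgroup.center N)) :=
      (Subgroup.map_comap_eq_self_of_surjective (QuotientGroup.mk'_surjective _) V).symm
    have h4 := Subgroup.relIndex_ker E (QuotientGroup.mk' (Subgroup.center N))
    rw [QuotientGroup.ker_mk'] at h4
    rw [h2, h3]
    exact h4
  refine ⟨p, u, E, hp, Nat.pos_of_ne_zero fun h => hVbot ?_, hindex.trans hu, fun z hz =>
    ⟨(hcenter z).1 hz, fun g => hZfix g _ ((hcenter z).1 hz)⟩, fun x y => ?_, fun x => ?_, hdvd⟩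
  · rw [h, pow_zero] at hu
    exact Subgroup.card_eq_one.1 hu
  · rw [hcenter, ← QuotientGroup.eq_one_iff]
    change (x.1 : N ⧸ Subgroup.center N) * y.1 * (x.1 : N ⧸ Subgroup.center N)⁻¹ *
      (y.1 : N ⧸ Subgroup.center N)⁻¹ = 1
    have h : (x.1 : N ⧸ Subgroup.center N) * y.1 = y.1 * x.1 := hVcomm _ x.2 _ y.2
    rw [h]
    group
  · rw [hcenter, ← QuotientGroup.eq_one_iff]
    exact hVp _ x.2

/-- There is no irreducible linear configuration consisting of a nontrivial solvable group `L` and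
an insoluble simple group acting on `L` by conjugation, nontrivially on all quotients of `L`, when
the order of the space divides the order of the simple group. -/
theorem IsSimpleGroup.not_irreducible_sup_range {q : ℕ} [Fact q.Prime] {W G : Type*}
    [AddCommGroup W] [Module (ZMod q) W] [Finite W] [Nontrivial W] [Group G] [Finite G]
    [IsSimpleGroup G] (hG : ¬ Group.IsSolvable G)
    (hcard : q ^ Module.finrank (ZMod q) W ∣ Nat.card G)
    (σ : G →* (Module.End (ZMod q) W)ˣ) (L : Subgroup (Module.End (ZMod q) W)ˣ) [Nontrivial L]
    (hL : Group.IsSolvable L) (hσL : ∀ g, ∀ x ∈ L, σ g * x * (σ g)⁻¹ ∈ L)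
    (h1 : ∀ K : Subgroup L, K.Normal → (∀ g, ∀ x ∈ K, ⟨_, hσL g x x.2⟩ ∈ K) →
      (∀ g, ∀ x : L, ⟨_, hσL g x x.2⟩ * x⁻¹ ∈ K) → K = ⊤)
    (hirr : ∀ S : Submodule (ZMod q) W, (∀ γ ∈ L, ∀ w ∈ S, γ.1 w ∈ S) →
      (∀ g, ∀ w ∈ S, (σ g).1 w ∈ S) → S = ⊥ ∨ S = ⊤) : False := by
  have : Finite (Module.End (ZMod q) W) := Finite.of_injective (fun f : Module.End (ZMod q) W =>
    (f : W → W)) DFunLike.coe_injective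
  let Γ := L ⊔ σ.range
  have hLΓ : L ≤ Γ := le_sup_left
  have hσΓ : ∀ g, σ g ∈ Γ := fun g => (le_sup_right : σ.range ≤ Γ) ⟨g, rfl⟩
  have hirrΓ : ∀ S : Submodule (ZMod q) W, (∀ γ ∈ Γ, ∀ w ∈ S, γ.1 w ∈ S) → S = ⊥ ∨ S = ⊤ :=
    fun S hS => hirr S (fun γ hγ => hS γ (hLΓ hγ)) fun g => hS _ (hσΓ g)
  let φ : G →* MulAut L := MulAut.restrictHom (MulAut.conj.comp σ) L hσL
  obtain ⟨p, u, E, hp, hu, hidx, hz, hcomm, hpow, hdvd⟩ :=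
    IsSimpleGroup.exists_class_two_subgroup hG hL φ h1 fun B hB hBφ hBc g b hb => by
      have := IsSimpleGroup.commute_of_irreducible hG hcard σ Γ (B.map L.subtype) hirrΓ hσΓ
        (Subgroup.le_normalizer_iff.1 (sup_le (Subgroup.le_normalizer_iff.2 ?_)
          (Subgroup.le_normalizer_iff.2 ?_))) ?_ g (b := b) ⟨b, hb, rfl⟩
      · exact Subtype.ext (mul_inv_eq_iff_eq_mul.2 this)
      · rintro x hx _ ⟨y, hy, rfl⟩
        exact ⟨_, hB.conj_mem y hy ⟨x, hx⟩, rfl⟩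
      · rintro _ ⟨x, rfl⟩ _ ⟨y, hy, rfl⟩
        exact ⟨_, hBφ x y hy, rfl⟩
      · rintro _ ⟨x, hx, rfl⟩ _ ⟨y, hy, rfl⟩
        exact congrArg Subtype.val (hBc x hx y hy)
  let e := E.equivMapOfInjective L.subtype L.subtype_injective
  have hcen : (Subgroup.center (E.map L.subtype)).comap e.toMonoidHom = Subgroup.center E := by
    ext z
    rw [Subgroup.mem_comap, Subgroup.mem_center_iff, Subgroup.mem_center_iff]
    constructor
    · intro h x
      have := h (e x)
      exact e.injective (by simpa using this)
    · intro h x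
      obtain ⟨x, rfl⟩ := e.surjective x
      have := congrArg e (h x)
      simpa using this
  have hcen' : ∀ z : E, e z ∈ Subgroup.center (E.map L.subtype) ↔ z ∈ Subgroup.center E :=
    fun z => by
      rw [← hcen]
      rfl
  have hidx' : (Subgroup.center (E.map L.subtype)).index = p ^ u := by
    rw [← hidx, ← hcen, Subgroup.index_comap_of_surjective _ e.surjective]
  obtain ⟨f, w, hpf, hfp, hfw, hle⟩ := Subgroup.exists_card_eq_pow_of_irreducible Γ
    (E.map L.subtype) hirrΓ ((Subgroup.map_subtype_le E).trans hLΓ) (fun z hz' => by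
      obtain ⟨z, rfl⟩ := e.surjective z
      obtain ⟨hz1, hz2⟩ := hz z ((hcen' z).1 hz')
      have hle : Γ ≤ Subgroup.centralizer {((z : L) : (Module.End (ZMod q) W)ˣ)} := by
        refine sup_le (fun x hx => ?_) ?_
        · rw [Subgroup.mem_centralizer_singleton_iff]
          exact congrArg Subtype.val (Subgroup.mem_center_iff.1 hz1 ⟨x, hx⟩)
        · rintro _ ⟨g, rfl⟩
          rw [Subgroup.mem_centralizer_singleton_iff]
          exact mul_inv_eq_iff_eq_mul.1 (congrArg Subtype.val (hz2 g))
      exact fun γ hγ => Subgroup.mem_centralizer_singleton_iff.1 (hle hγ)) (fun x y => by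
      obtain ⟨x, rfl⟩ := e.surjective x
      obtain ⟨y, rfl⟩ := e.surjective y
      simpa using (hcen' _).2 (hcomm x y)) hp (fun x => by
      obtain ⟨x, rfl⟩ := e.surjective x
      simpa using (hcen' _).2 (hpow x)) fun h => by
        rw [h, Subgroup.index_top] at hidx'
        exact (Nat.one_lt_pow hu.ne' hp.one_lt).ne hidx'
  rw [hidx'] at hle
  exact Nat.not_pow_dvd_prod_pow_sub_pow hp hpf hfp hu hle (hfw ▸ hcard.trans hdvd)

/-- A nontrivial solvable group with an action of an insoluble simple group of divisible order that
is nontrivial on all nontrivial quotients has nontrivial center. -/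
theorem IsSimpleGroup.center_ne_bot {G N : Type*} [Group G] [Finite G]
    [IsSimpleGroup G] (hG : ¬ Group.IsSolvable G) [Group N] [Finite N] [Nontrivial N]
    (hN : Group.IsSolvable N) (hcard : Nat.card N ∣ Nat.card G) (φ : G →* MulAut N)
    (h1 : ∀ K : Subgroup N, K.Normal → (∀ g, ∀ x ∈ K, φ g x ∈ K) →
      (∀ g x, φ g x * x⁻¹ ∈ K) → K = ⊤) : Subgroup.center N ≠ ⊥ := by
  intro hZ
  obtain ⟨q, hq, V, hVchar, hVbot, hVcomm, hVq⟩ :=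
    Group.exists_characteristic_elementary_abelian N hN
  have : Fact q.Prime := ⟨hq⟩
  obtain ⟨X, hXV, ⟨hXbot, hXn, hXφ⟩, hXmin⟩ := exists_minimal_le_of_wellFoundedLT
    (fun X : Subgroup N => X ≠ ⊥ ∧ X.Normal ∧ ∀ g, ∀ x ∈ X, φ g x ∈ X) V
    ⟨hVbot, inferInstance, fun g x hx => hVchar.apply_mem (φ g) hx⟩
  have hXnt : Nontrivial X := (Subgroup.nontrivial_iff_ne_bot X).2 hXbot
  let : CommGroup X :=
    { (inferInstance : Group X) with
      mul_comm := fun x y => Subtype.ext (hVcomm x (hXV x.2) y (hXV y.2)) }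
  let : Module (ZMod q) (Additive X) := AddCommGroup.zmodModule (n := q) fun v =>
    Subtype.ext (hVq v.toMul.1 (hXV v.toMul.2))
  have : Module.Finite (ZMod q) (Additive X) := Module.Finite.of_finite
  let μ := MulAut.toZModUnits q X
  let ν : N →* (Module.End (ZMod q) (Additive X))ˣ := μ.comp MulAut.conjNormal
  let σ : G →* (Module.End (ZMod q) (Additive X))ˣ := μ.comp (MulAut.restrictHom φ X hXφ)
  have hσν : ∀ g x, σ g * ν x * (σ g)⁻¹ = ν (φ g x) := fun g x => by
    rw [mul_inv_eq_iff_eq_mul]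
    change μ _ * μ _ = μ _ * μ _
    rw [← map_mul, ← map_mul]
    refine congrArg μ (MulEquiv.ext fun y => Subtype.ext ?_)
    change φ g (x * y * x⁻¹) = φ g x * φ g y * (φ g x)⁻¹
    rw [map_mul, map_mul, map_inv]
  have hσL : ∀ g, ∀ x ∈ ν.range, σ g * x * (σ g)⁻¹ ∈ ν.range := by
    rintro g _ ⟨x, rfl⟩
    exact ⟨_, (hσν g x).symm⟩
  have hnt : Nontrivial ν.range := by
    rw [Subgroup.nontrivial_iff_ne_bot]
    intro h
    refine hXbot (eq_bot_iff.2 (hZ ▸ fun y hy => Subgroup.mem_center_iff.2 fun x => ?_))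
    have h2 : ν x = 1 := by
      rw [← Subgroup.mem_bot, ← h]
      exact ⟨x, rfl⟩
    have h3 : MulAut.conjNormal (H := X) x = 1 :=
      MulAut.toZModUnits_injective q X (h2.trans (map_one μ).symm)
    have h4 : x * y * x⁻¹ = y := congrArg (fun s : MulAut X => (s ⟨y, hy⟩).1) h3
    exact mul_inv_eq_iff_eq_mul.1 h4
  have hνX : ∀ x y, (ν x).1 (Additive.ofMul y) = Additive.ofMul (MulAut.conjNormal x y) :=
    fun _ _ => rfl
  have hσX : ∀ g y, (σ g).1 (Additive.ofMul y) =
    Additive.ofMul (MulAut.restrictHom φ X hXφ g y) := fun _ _ => rfl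
  clear_value ν σ
  refine IsSimpleGroup.not_irreducible_sup_range hG (q := q) (W := Additive X) ?_ σ ν.range
    (Group.isSolvable_of_surjective ν.rangeRestrict_surjective) hσL
    (fun K hK hKφ hK1 => ?_) fun S hSν hSσ => ?_
  · have h2 : q ^ Module.finrank (ZMod q) (Additive X) = Nat.card X := by
      rw [Nat.card_congr Additive.ofMul, Module.natCard_eq_pow_finrank (K := ZMod q), Nat.card_zmod]
    rw [h2]
    exact (Subgroup.card_subgroup_dvd_card X).trans hcard
  · have hrr : ∀ g x, ν.rangeRestrict (φ g x) = ⟨_, hσL g (ν x) ⟨x, rfl⟩⟩ := fun g x =>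
      Subtype.ext (hσν g x).symm
    have h2 := h1 (K.comap ν.rangeRestrict) inferInstance (fun g x hx => by
      rw [Subgroup.mem_comap, hrr]
      exact hKφ g _ hx) fun g x => by
        rw [Subgroup.mem_comap, map_mul, map_inv, hrr]
        exact hK1 g (ν.rangeRestrict x)
    rw [eq_top_iff]
    intro y _
    obtain ⟨x, rfl⟩ := ν.rangeRestrict_surjective y
    exact (h2 ▸ Subgroup.mem_top x : x ∈ K.comap ν.rangeRestrict)
  · let T : Subgroup N := (AddSubgroup.toSubgroup' S.toAddSubgroup).map X.subtype
    by_cases hS : S = ⊥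
    · exact Or.inl hS
    refine Or.inr (eq_top_iff.2 fun y _ => ?_)
    have hXT : X ≤ T := hXmin ⟨fun h => hS ?_, ⟨?_⟩, ?_⟩ (Subgroup.map_subtype_le _)
    · obtain ⟨z, hz, hzy⟩ := hXT y.toMul.2
      have : z = y.toMul := Subtype.ext hzy
      rw [this] at hz
      exact hz
    · rw [eq_bot_iff]
      intro w hw
      have h2 : (w.toMul : N) ∈ T := ⟨w.toMul, hw, rfl⟩
      rw [h, Subgroup.mem_bot] at h2
      have h3 : w.toMul = 1 := Subtype.ext h2
      exact h3
    · rintro _ ⟨z, hz, rfl⟩ x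
      have h2 := hSν (ν x) ⟨x, rfl⟩ (Additive.ofMul z) hz
      rw [hνX] at h2
      exact ⟨_, h2, rfl⟩
    · rintro g _ ⟨z, hz, rfl⟩
      have h2 := hSσ g (Additive.ofMul z) hz
      rw [hσX] at h2
      exact ⟨_, h2, rfl⟩

/-- A solvable group with an action of an insoluble simple group of divisible order that is
nontrivial on all nontrivial quotients is nilpotent. -/
theorem IsSimpleGroup.isNilpotent_of_mulAut {G : Type*} [Group G] [Finite G]
    [IsSimpleGroup G] (hG : ¬ Group.IsSolvable G) {N : Type*} [Group N] [Finite N]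
    (hN : Group.IsSolvable N) (hcard : Nat.card N ∣ Nat.card G) (φ : G →* MulAut N)
    (h1 : ∀ K : Subgroup N, K.Normal → (∀ g, ∀ x ∈ K, φ g x ∈ K) →
      (∀ g x, φ g x * x⁻¹ ∈ K) → K = ⊤) : Group.IsNilpotent N := by
  induction hn : Nat.card N using Nat.strong_induction_on generalizing N with
  | _ n ih =>
  subst hn
  rcases subsingleton_or_nontrivial N with hsub | hnt
  · infer_instance
  have hZ := IsSimpleGroup.center_ne_bot hG hN hcard φ h1
  have hZφ : ∀ g, ∀ x ∈ Subgroup.center N, φ g x ∈ Subgroup.center N := fun g x hx =>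
    Subgroup.centerCharacteristic.apply_mem (φ g) hx
  have hlt : Nat.card (N ⧸ Subgroup.center N) < Nat.card N := by
    have h2 := Subgroup.card_eq_card_quotient_mul_card_subgroup (Subgroup.center N)
    have h3 : 1 < Nat.card (Subgroup.center N) := (Subgroup.one_lt_card_iff_ne_bot _).2 hZ
    rw [h2]
    exact lt_mul_of_one_lt_right Nat.card_pos h3
  have := ih _ hlt (N := N ⧸ Subgroup.center N) inferInstance
    ((Subgroup.card_quotient_dvd_card _).trans hcard)
    (MulAut.quotientHom φ (Subgroup.center N) hZφ) (fun K hK hKφ hK1 => by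
      have h2 := h1 (K.comap (QuotientGroup.mk' (Subgroup.center N))) inferInstance
        (fun g x hx => hKφ g _ hx) fun g x => hK1 g x
      rw [eq_top_iff]
      intro y _
      obtain ⟨x, rfl⟩ := QuotientGroup.mk_surjective y
      exact (h2 ▸ Subgroup.mem_top x : x ∈ K.comap (QuotientGroup.mk' (Subgroup.center N)))) rfl
  exact Group.of_quotient_center_nilpotent this

/-- In a simple group, a subgroup `K` whose index is prime to `q` and to the index of a subgroup
`H` with a nontrivial normal `q`-subgroup is the whole group. -/
theorem IsSimpleGroup.eq_top_of_coprime_index {G : Type*} [Group G] [Finite G] [IsSimpleGroup G]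
    {H K : Subgroup G} (hHK : H.index.Coprime K.index) {q : ℕ} (hq : q.Prime)
    (hqK : ¬ q ∣ K.index) {M : Subgroup G} (hHM : H ≤ Subgroup.normalizer (M : Set G))
    (hM : M ≠ ⊥) (hMq : IsPGroup q M) : K = ⊤ := by
  have : Fact q.Prime := ⟨hq⟩
  obtain ⟨x, hx⟩ := hMq.nonempty_fixed_point_of_prime_not_dvd_card (G ⧸ K) hqK
  let S := MulAction.stabilizer G x
  have hSK : S.index = K.index := by
    rw [MulAction.index_stabilizer_of_transitive]
    rfl
  have hrel : S.relIndex H = (MulAction.orbit H x).ncard := by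
    rw [← MulAction.index_stabilizer]
    rfl
  have hdvd : K.index ∣ S.relIndex H := by
    refine hHK.symm.dvd_of_dvd_mul_right ?_
    rw [← Subgroup.inf_relIndex_right, Subgroup.relIndex_mul_index inf_le_right, ← hSK]
    exact Subgroup.index_dvd_of_le inf_le_left
  have horb : MulAction.orbit H x = Set.univ := by
    rw [hrel] at hdvd
    refine Set.eq_of_subset_of_ncard_le (Set.subset_univ _) ?_
    rw [Set.ncard_univ]
    refine Nat.le_of_dvd ?_ hdvd
    exact (Set.ncard_pos (Set.toFinite _)).2 ⟨x, MulAction.mem_orbit_self x⟩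
  have hfix : ∀ m ∈ M, ∀ y : G ⧸ K, m • y = y := fun m hm y => by
    obtain ⟨h, rfl⟩ : y ∈ MulAction.orbit H x := horb ▸ Set.mem_univ y
    have h1 := (Subgroup.mem_normalizer_iff.1 (inv_mem (hHM h.2)) m).1 hm
    rw [inv_inv] at h1
    have h2 : ((h : G)⁻¹ * m * h) • x = x := hx ⟨_, h1⟩
    change m • (h : G) • x = (h : G) • x
    rw [mul_assoc, mul_smul, inv_smul_eq_iff, mul_smul] at h2
    exact h2
  have hMcore : M ≤ K.normalCore := fun m hm => by
    rw [Subgroup.normalCore_eq_ker, MonoidHom.mem_ker]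
    exact Equiv.ext (hfix m hm)
  have htop := (inferInstance : K.normalCore.Normal).eq_bot_or_eq_top.resolve_left
    fun h => hM (eq_bot_iff.2 (h ▸ hMcore))
  exact eq_top_iff.2 (htop ▸ K.normalCore_le)

/-- Wielandt's theorem for simple groups. -/
theorem IsSimpleGroup.isSolvable_of_coprime_index {G : Type*} [Group G] [Finite G]
    [IsSimpleGroup G] {H₁ H₂ H₃ : Subgroup G} (hs₁ : Group.IsSolvable H₁)
    (hs₂ : Group.IsSolvable H₂) (hs₃ : Group.IsSolvable H₃) (h₁₂ : H₁.index.Coprime H₂.index)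
    (h₁₃ : H₁.index.Coprime H₃.index) (h₂₃ : H₂.index.Coprime H₃.index) :
    Group.IsSolvable G := by
  have htop : ∀ {H : Subgroup G}, Group.IsSolvable H → H = ⊤ → Group.IsSolvable G := by
    rintro H hs rfl
    exact Group.isSolvable_of_surjective (f := (Subgroup.topEquiv (G := G)).toMonoidHom)
      Subgroup.topEquiv.surjective
  rcases subsingleton_or_nontrivial H₁ with hsub | hnt
  · refine htop hs₂ (Subgroup.index_eq_one.1 (Nat.Coprime.eq_one_of_dvd h₁₂.symm ?_))
    rw [Subgroup.eq_bot_of_subsingleton H₁, Subgroup.index_bot]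
    exact Subgroup.index_dvd_card H₂
  obtain ⟨q, hq, V, hVchar, hVbot, -, hVq⟩ := Group.exists_characteristic_elementary_abelian H₁ hs₁
  have hMbot : V.map H₁.subtype ≠ ⊥ := fun h =>
    hVbot ((Subgroup.map_eq_bot_iff_of_injective V H₁.subtype_injective).1 h)
  have hMq : IsPGroup q (V.map H₁.subtype) := by
    rintro ⟨_, x, hx, rfl⟩
    exact ⟨1, Subtype.ext (by simpa using congrArg Subtype.val (hVq x hx))⟩
  have hMn : H₁ ≤ Subgroup.normalizer (V.map H₁.subtype : Set G) := by
    rw [Subgroup.le_normalizer_iff]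
    rintro h hh _ ⟨x, hx, rfl⟩
    exact ⟨_, (inferInstance : V.Normal).conj_mem x hx ⟨h, hh⟩, rfl⟩
  by_cases h : q ∣ H₂.index
  · refine htop hs₃ (IsSimpleGroup.eq_top_of_coprime_index h₁₃ hq (fun h' => ?_) hMn hMbot hMq)
    exact hq.one_lt.ne' (Nat.eq_one_of_dvd_coprimes h₂₃ h h')
  · exact htop hs₂ (IsSimpleGroup.eq_top_of_coprime_index h₁₂ hq h hMn hMbot hMq)

/-- Burnside's theorem for simple groups. -/
theorem IsSimpleGroup.isSolvable_of_card_eq_pow_mul_pow {G : Type*} [Group G] [Finite G]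
    [IsSimpleGroup G] {p q a b : ℕ} (hp : p.Prime) (hq : q.Prime)
    (h : Nat.card G = p ^ a * q ^ b) : Group.IsSolvable G := by
  by_contra hG
  have : Fact p.Prime := ⟨hp⟩
  have : Fact q.Prime := ⟨hq⟩
  obtain ⟨P⟩ := (inferInstance : Nonempty (Sylow p G))
  have hP0 : ¬ p ∣ (P : Subgroup G).index := P.not_dvd_index
  have hPb : (P : Subgroup G).index ∣ q ^ b := by
    have h1 := Subgroup.index_dvd_card (P : Subgroup G)
    rw [h] at h1
    exact (((Nat.Prime.coprime_iff_not_dvd hp).2 hP0).symm.pow_right a).dvd_of_dvd_mul_left h1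
  rcases subsingleton_or_nontrivial P with hsub | hnt
  · rw [Subgroup.eq_bot_of_subsingleton (P : Subgroup G), Subgroup.index_bot] at hPb
    obtain ⟨k, -, hk⟩ := (Nat.dvd_prime_pow hq).1 hPb
    have := (IsPGroup.of_card hk).isNilpotent
    exact hG inferInstance
  have hc := P.isPGroup'.center_nontrivial
  obtain ⟨z, hz⟩ := exists_ne (1 : Subgroup.center P)
  have hz1 : (z.1 : G) ≠ 1 := fun h => hz (Subtype.ext (Subtype.ext h))
  have hle : (P : Subgroup G) ≤ Subgroup.centralizer {(z.1 : G)} := fun x hx => by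
    rw [Subgroup.mem_centralizer_singleton_iff]
    exact congrArg Subtype.val (Subgroup.mem_center_iff.1 z.2 ⟨x, hx⟩)
  obtain ⟨k, -, hk⟩ := (Nat.dvd_prime_pow hq).1 ((Subgroup.index_dvd_of_le hle).trans hPb)
  refine IsSimpleGroup.card_conj_ne_prime_pow hG hz1 (Set.toFinite {x | IsConj z.1.1 x}).toFinset
    (fun x => by simp) hq k ?_
  rw [← Set.ncard_eq_toFinset_card, ← hk]
  have h2 := MulAction.index_stabilizer (ConjAct G) (z.1 : G)
  rw [ConjAct.stabilizer_eq_centralizer] at h2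
  refine Eq.trans ?_ h2.symm
  congr 1
  ext x
  rw [ConjAct.mem_orbit_conjAct, isConj_comm]
  rfl

/-- The normal `p`-complement of a finite nilpotent group. -/
theorem Group.IsNilpotent.exists_characteristic_index_eq_pow {N : Type*} [Group N] [Finite N]
    (hN : Group.IsNilpotent N) {p : ℕ} (hp : p.Prime) (hpN : p ∣ Nat.card N) :
    ∃ K : Subgroup N, K.Characteristic ∧ ¬ p ∣ Nat.card K ∧ ∃ a, K.index = p ^ a := by
  have : Fact p.Prime := ⟨hp⟩
  obtain ⟨e⟩ := (Group.isNilpotent_of_finite_tfae.out 0 4 rfl rfl).1 hN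
  let p' : (Nat.card N).primeFactors := ⟨p, Nat.mem_primeFactors.2 ⟨hp, hpN, Nat.card_pos.ne'⟩⟩
  let f : N →* (∀ P : Sylow p N, (P : Subgroup N)) :=
    (Pi.evalMonoidHom (fun r : (Nat.card N).primeFactors => ∀ P : Sylow r N, (P : Subgroup N))
      p').comp e.symm.toMonoidHom
  have hcop : ¬ p ∣ Nat.card f.ker := fun h => by
    obtain ⟨x, hx⟩ := exists_prime_orderOf_dvd_card' (G := f.ker) p h
    have hxp : (x : N) ^ p = 1 := by
      exact orderOf_dvd_iff_pow_eq_one.1 (((Subgroup.orderOf_coe x).trans hx).dvd)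
    have hx1 : e.symm x = 1 := by
      funext r
      by_cases hr : r = p'
      · subst hr
        exact x.2
      · funext P
        have : Fact r.1.Prime := ⟨Nat.prime_of_mem_primeFactors r.2⟩
        have h1 : (e.symm x r P) ^ p = 1 := by
          have := congrArg e.symm hxp
          rw [map_pow, map_one] at this
          exact congrFun (congrFun this r) P
        obtain ⟨k, hk⟩ := P.isPGroup' (e.symm x r P)
        have hco : Nat.Coprime p (r.1 ^ k) :=
          ((Nat.coprime_primes hp this.out).2 fun h => hr (Subtype.ext h.symm)).pow_right k
        rw [← orderOf_dvd_iff_pow_eq_one] at h1 hk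
        exact orderOf_eq_one_iff.1 (Nat.eq_one_of_dvd_coprimes hco h1 hk)
    have hx2 : x = 1 := Subtype.ext ((map_eq_one_iff e.symm e.symm.injective).1 hx1)
    rw [hx2, orderOf_one] at hx
    exact hp.one_lt.ne hx
  have hmem : ∀ x, ¬ p ∣ orderOf x → x ∈ f.ker := fun x hx => by
    rw [MonoidHom.mem_ker]
    funext P
    obtain ⟨k, hk⟩ := P.isPGroup' (f x P)
    have h1 : (f x P) ^ orderOf x = 1 := by
      have := congrArg f (pow_orderOf_eq_one x)
      rw [map_pow, map_one] at this
      exact congrFun this P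
    rw [← orderOf_dvd_iff_pow_eq_one] at h1 hk
    exact orderOf_eq_one_iff.1 (Nat.eq_one_of_dvd_coprimes
      (((Nat.Prime.coprime_iff_not_dvd hp).2 hx).symm.pow_right k) h1 hk)
  refine ⟨f.ker, Subgroup.characteristic_iff_le_comap.2 fun s x hx => hmem _ ?_, hcop, ?_⟩
  · rw [MulEquiv.coe_toMonoidHom, MulEquiv.orderOf_eq]
    exact fun h => hcop (h.trans (Subgroup.orderOf_dvd_natCard f.ker hx))
  · rw [Subgroup.index_ker]
    refine IsPGroup.iff_card.1 fun y => ⟨(Nat.card N).factorization p, Subtype.ext ?_⟩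
    funext P
    have h1 : (y.1 P) ^ Nat.card P = 1 := pow_card_eq_one'
    rw [P.card_eq_multiplicity] at h1
    exact h1

theorem Nat.exists_eq_pow_mul_pow_or_three_primes {n : ℕ} (hn : n ≠ 0) :
    (∃ p q a b : ℕ, p.Prime ∧ q.Prime ∧ n = p ^ a * q ^ b) ∨
      ∃ p q r : ℕ, p.Prime ∧ q.Prime ∧ r.Prime ∧ p ≠ q ∧ p ≠ r ∧ q ≠ r ∧
        p ∣ n ∧ q ∣ n ∧ r ∣ n := by
  by_cases h1 : n = 1
  · exact Or.inl ⟨2, 2, 0, 0, Nat.prime_two, Nat.prime_two, by simpa using h1⟩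
  obtain ⟨p, hp, hpn⟩ := Nat.exists_prime_and_dvd h1
  obtain ⟨a, m, hpm, hm⟩ := Nat.exists_eq_pow_mul_and_not_dvd hn p hp.ne_one
  by_cases h2 : m = 1
  · exact Or.inl ⟨p, p, a, 0, hp, hp, by rw [hm, h2, pow_zero]⟩
  obtain ⟨q, hq, hqm⟩ := Nat.exists_prime_and_dvd h2
  have hm0 : m ≠ 0 := fun h => hpm (h ▸ dvd_zero p)
  obtain ⟨b, l, hql, hl⟩ := Nat.exists_eq_pow_mul_and_not_dvd hm0 q hq.ne_one
  by_cases h3 : l = 1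
  · exact Or.inl ⟨p, q, a, b, hp, hq, by rw [hm, hl, h3, mul_one]⟩
  obtain ⟨r, hr, hrl⟩ := Nat.exists_prime_and_dvd h3
  have hlm : l ∣ m := hl ▸ dvd_mul_left l _
  have hmn : m ∣ n := hm ▸ dvd_mul_left m _
  refine Or.inr ⟨p, q, r, hp, hq, hr, ?_, ?_, ?_, hpn, hqm.trans hmn, (hrl.trans hlm).trans hmn⟩
  · rintro rfl
    exact hpm hqm
  · rintro rfl
    exact hpm (hrl.trans hlm)
  · rintro rfl
    exact hql hrl

theorem SkewBrace.one_eq_zero (A : Type*) [SkewBrace A] : (1 : A) = 0 := by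
  have h := SkewBrace.compat (1 : A) 0 0
  rw [one_mul, one_mul, add_zero, zero_add, add_zero] at h
  exact neg_eq_zero.1 h.symm

/-- The action of the multiplicative group of a skew brace on the additive group. -/
def SkewBrace.lambda (A : Type*) [SkewBrace A] : A →* MulAut (Multiplicative A) where
  toFun g :=
    { toFun := fun x => Multiplicative.ofAdd (-g + g * x.toAdd)
      invFun := fun x => Multiplicative.ofAdd (g⁻¹ * (g + x.toAdd))
      left_inv := fun x => by
        change g⁻¹ * (g + (-g + g * x.toAdd)) = x.toAdd
        rw [add_neg_cancel_left, inv_mul_cancel_left]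
      right_inv := fun x => by
        change -g + g * (g⁻¹ * (g + x.toAdd)) = x.toAdd
        rw [mul_inv_cancel_left, neg_add_cancel_left]
      map_mul' := fun x y => by
        change -g + g * (x.toAdd + y.toAdd) = -g + g * x.toAdd + (-g + g * y.toAdd)
        rw [SkewBrace.compat]
        simp only [add_assoc] }
  map_one' := MulEquiv.ext fun x => by
    change -1 + 1 * x.toAdd = x.toAdd
    rw [one_mul, SkewBrace.one_eq_zero, neg_zero, zero_add]
  map_mul' g h := MulEquiv.ext fun x => by
    change -(g * h) + g * h * x.toAdd = -g + g * (-h + h * x.toAdd)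
    have h1 := SkewBrace.compat g h (-h + h * x.toAdd)
    rw [add_neg_cancel_left, ← mul_assoc] at h1
    rw [h1, add_assoc (g * h), neg_add_cancel_left]

theorem SkewBrace.lambda_apply {A : Type*} [SkewBrace A] (g : A) (x : Multiplicative A) :
    SkewBrace.lambda A g x = Multiplicative.ofAdd (-g + g * x.toAdd) := rfl

theorem SkewBrace.ofAdd_mul {A : Type*} [SkewBrace A] (g h : A) :
    Multiplicative.ofAdd (g * h) =
      Multiplicative.ofAdd g * SkewBrace.lambda A g (Multiplicative.ofAdd h) :=
  (add_neg_cancel_left g (g * h)).symm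

/-- The subgroup of the multiplicative group of a skew brace underlying a subgroup of the additive
group that is invariant under the action. -/
def SkewBrace.mulSubgroup {A : Type*} [SkewBrace A] (K : Subgroup (Multiplicative A))
    (hK : ∀ g, ∀ x ∈ K, SkewBrace.lambda A g x ∈ K) : Subgroup A where
  carrier := {a | Multiplicative.ofAdd a ∈ K}
  one_mem' := by
    rw [Set.mem_ofPred_eq, SkewBrace.one_eq_zero]
    exact one_mem K
  mul_mem' {a b} ha hb := by
    rw [Set.mem_ofPred_eq, SkewBrace.ofAdd_mul]
    exact mul_mem ha (hK a _ hb)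
  inv_mem' {a} ha := by
    rw [Set.mem_ofPred_eq]
    have h := hK a⁻¹ (Multiplicative.ofAdd a)⁻¹ (inv_mem ha)
    have h2 : SkewBrace.lambda A a (Multiplicative.ofAdd a⁻¹) = (Multiplicative.ofAdd a)⁻¹ := by
      rw [SkewBrace.lambda_apply, toAdd_ofAdd, mul_inv_cancel, SkewBrace.one_eq_zero, add_zero,
        ofAdd_neg]
    rwa [← h2, ← MulAut.mul_apply, ← map_mul, inv_mul_cancel, map_one, MulAut.one_apply] at h

/-- The skew brace structure on an invariant subgroup. -/
abbrev SkewBrace.ofSubgroup {A : Type*} [SkewBrace A] (K : Subgroup (Multiplicative A))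
    (hK : ∀ g, ∀ x ∈ K, SkewBrace.lambda A g x ∈ K) : SkewBrace (SkewBrace.mulSubgroup K hK) :=
  { (inferInstance : Group (SkewBrace.mulSubgroup K hK)),
    (inferInstance : AddGroup (Subgroup.toAddSubgroup' K)) with
    compat := fun a b c => Subtype.ext (SkewBrace.compat a.1 b.1 c.1) }

/-- If all skew braces of smaller order with solvable additive group have solvable multiplicative
group, then this holds for the proper characteristic subgroups of the additive group. -/
theorem SkewBrace.isSolvable_mulSubgroup {A : Type} [Fintype A] [SkewBrace A]
    (hadd : Group.IsSolvable (Multiplicative A))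
    (hmin : ∀ (B : Type) [Fintype B] [SkewBrace B], Fintype.card B < Fintype.card A →
      Group.IsSolvable (Multiplicative B) → Group.IsSolvable B) (K : Subgroup (Multiplicative A))
    (hK : ∀ g, ∀ x ∈ K, SkewBrace.lambda A g x ∈ K) (htop : K ≠ ⊤) :
    Group.IsSolvable (SkewBrace.mulSubgroup K hK) := by
  classical
  let : SkewBrace (SkewBrace.mulSubgroup K hK) := SkewBrace.ofSubgroup K hK
  let : Fintype (SkewBrace.mulSubgroup K hK) := Fintype.ofFinite _
  refine hmin (SkewBrace.mulSubgroup K hK) ?_ ?_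
  · obtain ⟨x, hx⟩ := SetLike.exists_not_mem_of_ne_top K htop rfl
    exact Fintype.card_subtype_lt (p := fun a => a ∈ SkewBrace.mulSubgroup K hK) (x := x.toAdd) hx
  · let f : Multiplicative (SkewBrace.mulSubgroup K hK) →* Multiplicative A :=
      { toFun := fun x => Multiplicative.ofAdd x.toAdd.1
        map_one' := rfl
        map_mul' := fun _ _ => rfl }
    exact Group.isSolvable_of_isSolvable_injective (f := f) fun x y h => Subtype.ext h

theorem SkewBrace.eq_top_of_lambda_mul_inv_mem {A : Type*} [SkewBrace A] [IsSimpleGroup A]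
    (hadd : Group.IsSolvable (Multiplicative A)) (hmul : ¬ Group.IsSolvable A)
    {K : Subgroup (Multiplicative A)} (hK : K.Normal)
    (h : ∀ g x, SkewBrace.lambda A g x * x⁻¹ ∈ K) : K = ⊤ := by
  let f : A →* Multiplicative A ⧸ K :=
    { toFun := fun a => (Multiplicative.ofAdd a : Multiplicative A)
      map_one' := by
        rw [SkewBrace.one_eq_zero]
        rfl
      map_mul' := fun a b => by
        rw [SkewBrace.ofAdd_mul, QuotientGroup.mk_mul]
        congr 1
        rw [QuotientGroup.eq_iff_div_mem, div_eq_mul_inv]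
        exact h a _ }
  rcases f.normal_ker.eq_bot_or_eq_top with hbot | htop
  · exact absurd (Group.isSolvable_of_isSolvable_injective ((f.ker_eq_bot_iff).1 hbot)) hmul
  · rw [eq_top_iff]
    intro x _
    have hx : x.toAdd ∈ f.ker := htop ▸ Subgroup.mem_top _
    exact (QuotientGroup.eq_one_iff x).1 hx

/-- If `A` is a minimal finite skew brace whose additive group is solvable and whose
multiplicative group is not solvable, then the multiplicative group of `A` is not simple. -/
theorem minimal_skewBrace_not_simple (A : Type) [Fintype A] [SkewBrace A]
    (hadd : IsSolvable (Multiplicative A))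
    (hmin : ∀ (B : Type) [Fintype B] [SkewBrace B], Fintype.card B < Fintype.card A →
      IsSolvable (Multiplicative B) → IsSolvable B)
    (hmul : ¬ IsSolvable A) :
    ¬ IsSimpleGroup A := by
  intro hsimple
  have hN : Group.IsSolvable (Multiplicative A) := hadd
  have hG : ¬ Group.IsSolvable A := hmul
  have hcard : Nat.card (Multiplicative A) = Nat.card A := Nat.card_congr Multiplicative.toAdd
  have hnil := IsSimpleGroup.isNilpotent_of_mulAut hG hN hcard.dvd (SkewBrace.lambda A)
    fun K hK _ h => SkewBrace.eq_top_of_lambda_mul_inv_mem hN hG hK h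
  have hall : ∀ p : ℕ, p.Prime → p ∣ Nat.card A →
      ∃ H : Subgroup A, Group.IsSolvable H ∧ ∃ a, H.index = p ^ a := fun p hp hpA => by
    obtain ⟨K, hK, hpK, a, ha⟩ := hnil.exists_characteristic_index_eq_pow hp (hcard ▸ hpA)
    have hKl : ∀ g, ∀ x ∈ K, SkewBrace.lambda A g x ∈ K := fun g x hx => hK.apply_mem _ hx
    refine ⟨SkewBrace.mulSubgroup K hKl, SkewBrace.isSolvable_mulSubgroup hN hmin K hKl ?_, a, ?_⟩
    · rintro rfl
      rw [Subgroup.card_top, hcard] at hpK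
      exact hpK hpA
    · have h1 := (SkewBrace.mulSubgroup K hKl).card_mul_index
      have h2 : Nat.card (SkewBrace.mulSubgroup K hKl) = Nat.card K := rfl
      rw [h2, ← hcard, ← K.card_mul_index, ha] at h1
      exact Nat.eq_of_mul_eq_mul_left Nat.card_pos h1
  rcases Nat.exists_eq_pow_mul_pow_or_three_primes (Nat.card_pos (α := A)).ne' with
    ⟨p, q, a, b, hp, hq, h⟩ | ⟨p, q, r, hp, hq, hr, hpq, hpr, hqr, hpA, hqA, hrA⟩
  · exact hG (IsSimpleGroup.isSolvable_of_card_eq_pow_mul_pow hp hq h)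
  · obtain ⟨H₁, hs₁, a, ha⟩ := hall p hp hpA
    obtain ⟨H₂, hs₂, b, hb⟩ := hall q hq hqA
    obtain ⟨H₃, hs₃, c, hc⟩ := hall r hr hrA
    refine hG (IsSimpleGroup.isSolvable_of_coprime_index hs₁ hs₂ hs₃ ?_ ?_ ?_)
    · rw [ha, hb]
      exact Nat.coprime_pow_primes a b hp hq hpq
    · rw [ha, hc]
      exact Nat.coprime_pow_primes a c hp hr hpr
    · rw [hb, hc]
      exact Nat.coprime_pow_primes b c hq hr hqr
end

section
/- Let n ≥ 3, let q be a prime power, and let p be a prime such that (q^n − 1)/(q − 1) is a power of p. If PSL_n(q) has a solvable p-complement, then either n = 3 and q = 2 (with p = 7), or n = 3 and q = 3 (with p = 13). -/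
open Matrix

theorem pred_card_le_ncard_of_two_pretransitive {G X : Type*} [Group G] [MulAction G X] [Finite X]
    [MulAction.IsMultiplyPretransitive G X 2] {p k j : ℕ} (hk : k ≠ 0) (hX : Nat.card X = p ^ k)
    {K : Subgroup G} (hK : K.index = p ^ j) {x y : X} (hxy : x ≠ y) {T : Set (X × X)}
    (hT : ∀ h ∈ K, (h • x, h • y) ∈ T) : Nat.card X - 1 ≤ T.ncard := by
  classical
  have := Fintype.ofFinite X
  set B := MulAction.stabilizer G (x, y)
  have hB : B.index = Nat.card X * (Nat.card X - 1) := by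
    rw [MulAction.index_stabilizer]
    have : MulAction.orbit G (x, y) = ((Finset.univ : Finset X).offDiag : Set (X × X)) := by
      ext ⟨a, b⟩
      simp only [MulAction.mem_orbit_iff, Finset.mem_coe, Finset.mem_offDiag, Finset.mem_univ,
        true_and, Prod.smul_mk, Prod.mk.injEq]
      constructor
      · rintro ⟨g, rfl, rfl⟩
        exact fun h ↦ hxy (MulAction.injective g h)
      · exact MulAction.is_two_pretransitive_iff.1 inferInstance hxy
    rw [this, Set.ncard_coe_finset, Finset.offDiag_card, Finset.card_univ, Nat.card_eq_fintype_card,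
      Nat.mul_sub_one]
  have hrel : B.relIndex K = (MulAction.orbit K (x, y)).ncard := by
    rw [← MulAction.index_stabilizer, Subgroup.relIndex]
    rfl
  have hdvd : B.index ∣ B.relIndex K * p ^ j := by
    rw [← hK, ← Subgroup.inf_relIndex_right, Subgroup.relIndex_mul_index inf_le_right]
    exact Subgroup.index_dvd_of_le inf_le_left
  have hcop : Nat.Coprime (Nat.card X - 1) (p ^ j) := by
    have h0 : 0 < Nat.card X := @Nat.card_pos _ ⟨x⟩ _
    refine Nat.Coprime.pow_right _ (Nat.Coprime.of_dvd_right (dvd_pow_self p hk) ?_)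
    rw [← hX]
    exact (Nat.coprime_self_sub_left h0).2 (Nat.coprime_one_left _)
  have hdvd' : Nat.card X - 1 ∣ B.relIndex K :=
    hcop.dvd_of_dvd_mul_right ((Dvd.intro_left _ hB.symm).trans hdvd)
  refine (Nat.le_of_dvd ?_ hdvd').trans ?_
  · rw [hrel]
    exact (Set.ncard_pos (Set.toFinite _)).2 (MulAction.nonempty_orbit _)
  · rw [hrel]
    refine Set.ncard_le_ncard ?_ (Set.toFinite _)
    rintro _ ⟨h, rfl⟩
    exact hT h h.2

theorem Matrix.exists_notMem_span_mulVec_eq_zero {ι F : Type*} [Fintype ι] [Field F]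
    {m : ℕ} (A : Matrix (Fin m) ι F) (hm : m + 2 ≤ Fintype.card ι) (v : ι → F) :
    ∃ y ∉ Submodule.span F {v}, A *ᵥ y = 0 := by
  by_contra! h
  have hker : LinearMap.ker A.mulVecLin ≤ Submodule.span F {v} := by
    intro y hy
    by_contra hyv
    exact h y hyv hy
  have h1 : Module.finrank F (LinearMap.ker A.mulVecLin) ≤ 1 :=
    (Submodule.finrank_mono hker).trans (by simpa using finrank_span_le_card ({v} : Set (ι → F)))
  have h2 := A.mulVecLin.finrank_range_add_finrank_ker
  have h3 := (LinearMap.range A.mulVecLin).finrank_le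
  rw [Module.finrank_fintype_fun_eq_card] at h2
  rw [Module.finrank_fintype_fun_eq_card, Fintype.card_fin] at h3
  lia

open scoped commutatorElement

namespace Matrix.SpecialLinearGroup

variable {ι κ F : Type*} [Fintype ι] [DecidableEq ι] [Fintype κ] [DecidableEq κ] [Field F]

/-- The embedding of special linear groups attached to a split injection `P`. -/
def ofSplit (P : Matrix ι κ F) (A : Matrix κ ι F) (h : A * P = 1) :
    SpecialLinearGroup κ F →* SpecialLinearGroup ι F where
  toFun g := ⟨1 + P * ((g.1 - 1) * A), by
    rw [det_one_add_mul_comm, Matrix.mul_assoc, h]; simp⟩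
  map_one' := by ext; simp
  map_mul' g g' := by
    apply Subtype.ext
    have h1 : P * ((g.1 - 1) * A) * (P * ((g'.1 - 1) * A)) =
        P * (((g.1 - 1) * (g'.1 - 1)) * A) := by
      calc _ = P * ((g.1 - 1) * ((A * P) * ((g'.1 - 1) * A))) := by simp only [Matrix.mul_assoc]
        _ = _ := by rw [h]; simp only [Matrix.mul_assoc, Matrix.one_mul]
    change 1 + P * ((g.1 * g'.1 - 1) * A) =
      (1 + P * ((g.1 - 1) * A)) * (1 + P * ((g'.1 - 1) * A))
    rw [Matrix.add_mul, Matrix.mul_add, Matrix.mul_add, h1]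
    simp only [Matrix.one_mul, Matrix.mul_one, ← Matrix.mul_add, ← Matrix.add_mul, add_assoc]
    congr 3
    noncomm_ring

theorem ofSplit_injective (P : Matrix ι κ F) (A : Matrix κ ι F) (h : A * P = 1) :
    Function.Injective (ofSplit P A h) := by
  intro g g' hg
  have h1 : (1 + P * ((g.1 - 1) * A)) = (1 + P * ((g'.1 - 1) * A)) := congrArg Subtype.val hg
  have h2 := congrArg (fun M ↦ A * M * P) (add_left_cancel h1)
  have h3 (M : Matrix κ κ F) : A * (P * (M * A)) * P = M := by
    calc _ = (A * P) * M * (A * P) := by simp only [Matrix.mul_assoc]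
      _ = _ := by simp [h]
  simp only [h3] at h2
  exact Subtype.ext (sub_left_injective h2)

theorem not_isSolvable_of_transvection_mem_fin_two [Finite F] (hF : 3 < Nat.card F)
    (K : Subgroup (SpecialLinearGroup (Fin 2) F))
    (hK : ∀ (i j : Fin 2) (hij : i ≠ j) (c : F), transvection hij c ∈ K) :
    ¬ Group.IsSolvable K := by
  have htop : K = ⊤ := (Subgroup.eq_top_iff' K).2 fun g ↦
    SL2.transvection_induction (· ∈ K) hK (fun _ _ ↦ mul_mem) g
  obtain ⟨a, ha, ha'⟩ : ∃ a : F, a ≠ 0 ∧ a ^ 2 ≠ 1 := by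
    obtain ⟨x, hx⟩ : IsCyclic Fˣ := inferInstance
    refine ⟨x, x.ne_zero, fun h ↦ ?_⟩
    have := Nat.le_of_dvd two_pos (orderOf_dvd_of_pow_eq_one (Units.ext h : x ^ 2 = 1))
    rw [orderOf_eq_card_of_forall_mem_zpowers hx] at this
    rw [Nat.card_eq_card_units_add_one F] at hF
    lia
  intro hsolv
  have : Group.IsSolvable (SpecialLinearGroup (Fin 2) F) :=
    Group.isSolvable_of_surjective (f := K.subtype) fun g ↦ ⟨⟨g, htop ▸ Subgroup.mem_top g⟩, rfl⟩
  have : Nontrivial (SpecialLinearGroup (Fin 2) F) :=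
    ⟨transvection zero_ne_one 1, 1, fun h ↦ by
      simpa [transvection_coe] using congrArg (fun g ↦ g.1 0 1) h⟩
  exact (Group.IsSolvable.commutator_lt_top_of_nontrivial _).ne (SL2.commutator_eq_top ha ha')

theorem not_isSolvable_of_transvection_mem_fin_three
    (K : Subgroup (SpecialLinearGroup (Fin 3) F))
    (hK : ∀ (i j : Fin 3) (hij : i ≠ j) (c : F), transvection hij c ∈ K) :
    ¬ Group.IsSolvable K := by
  have key (N : ℕ) : ∀ (i j : Fin 3) (hij : i ≠ j) (c : F),
      (⟨transvection hij c, hK i j hij c⟩ : K) ∈ derivedSeries K N := by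
    induction N with
    | zero => simp
    | succ N ih =>
      intro i j hij c
      obtain ⟨l, hil, hlj⟩ : ∃ l, i ≠ l ∧ l ≠ j := by
        revert i j; decide
      have h : (⟨transvection hij c, hK i j hij c⟩ : K) =
          ⁅(⟨transvection hil c, hK _ _ _ _⟩ : K), (⟨transvection hlj 1, hK _ _ _ _⟩ : K)⁆ := by
        rw [commutatorElement_def]
        apply Subtype.ext
        simp only [Subgroup.coe_mul, Subgroup.coe_inv, transvection_inv]
        apply Subtype.ext
        simp only [transvection_coe, coe_mul]
        simp [Matrix.add_mul, Matrix.mul_add, hij.symm, hil.symm, hlj.symm,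
          single_mul_single_of_ne, ← single_neg]
        abel
      rw [h, derivedSeries_succ]
      exact Subgroup.commutator_mem_commutator (ih _ _ _ _) (ih _ _ _ _)
  refine not_isSolvable_of_mem_derivedSeries (g := ⟨_, hK 0 1 (by decide) 1⟩) ?_
    fun N ↦ key N _ _ _ _
  intro h
  have := congrArg (fun g : K ↦ g.1.1 0 1) h
  simp [transvection_coe] at this

/-- `K` contains all transvections whose image is the line spanned by `w`. -/
def ContainsTransvections (K : Subgroup (SpecialLinearGroup ι F)) (w : ι → F) : Prop :=
  ∀ (g : SpecialLinearGroup ι F) (a : ι → F), a ⬝ᵥ w = 0 → g.1 = 1 + vecMulVec w a → g ∈ K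

theorem ContainsTransvections.mulVec {K : Subgroup (SpecialLinearGroup ι F)} {w : ι → F}
    (hw : ContainsTransvections K w) {h : SpecialLinearGroup ι F} (hh : h ∈ K) :
    ContainsTransvections K (h.1 *ᵥ w) := by
  intro g a ha hg
  have h1 : h⁻¹.1 * h.1 = 1 := by rw [← coe_mul]; simp
  have key : h⁻¹ * g * h ∈ K := by
    refine hw _ (a ᵥ* h.1) (by rwa [← dotProduct_mulVec]) ?_
    rw [coe_mul, coe_mul, hg, Matrix.mul_add, Matrix.add_mul, Matrix.mul_one, h1, mul_vecMulVec,
      vecMulVec_mul, mulVec_mulVec, h1, one_mulVec]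
  have := K.mul_mem (K.mul_mem hh key) (K.inv_mem hh)
  simpa [mul_assoc] using this

theorem ContainsTransvections.exists_ofSplit {K : Subgroup (SpecialLinearGroup ι F)}
    {w : κ → ι → F} (hw : ∀ i, ContainsTransvections K (w i)) (hli : LinearIndependent F w) :
    ∃ f : SpecialLinearGroup κ F →* SpecialLinearGroup ι F, Function.Injective f ∧
      ∀ (i j : κ) (hij : i ≠ j) (c : F), transvection hij c ∈ K.comap f := by
  obtain ⟨A, hA⟩ : ∃ A : Matrix κ ι F, A * (of w)ᵀ = 1 := by
    have hinj : Function.Injective (Matrix.toLin' (of w)ᵀ) :=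
      mulVec_injective_iff.2 hli
    obtain ⟨l, hl⟩ := (Matrix.toLin' (of w)ᵀ).exists_leftInverse_of_injective
      (LinearMap.ker_eq_bot.2 hinj)
    refine ⟨LinearMap.toMatrix' l, ?_⟩
    have := congrArg LinearMap.toMatrix' hl
    rwa [LinearMap.toMatrix'_comp, LinearMap.toMatrix'_toLin', LinearMap.toMatrix'_id] at this
  refine ⟨ofSplit _ A hA, ofSplit_injective _ A hA, fun i j hij c ↦ ?_⟩
  refine hw i _ (c • A j) ?_ ?_
  · have : A j ⬝ᵥ w i = (A * (of w)ᵀ) j i := rfl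
    rw [smul_dotProduct, this, hA, one_apply_ne hij.symm, smul_zero]
  · change 1 + (of w)ᵀ * (((transvection hij c).1 - 1) * A) = _
    rw [transvection_coe, add_sub_cancel_left]
    congr 1
    ext x y
    simp [Matrix.mul_apply, single_apply, vecMulVec_apply, ite_and]

theorem ContainsTransvections.card_le_three [Finite F] {K : Subgroup (SpecialLinearGroup ι F)}
    [Group.IsSolvable K] {w : Fin 2 → ι → F} (hw : ∀ i, ContainsTransvections K (w i))
    (hli : LinearIndependent F w) : Nat.card F ≤ 3 := by
  obtain ⟨f, hf, hK⟩ := ContainsTransvections.exists_ofSplit hw hli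
  by_contra! hF
  refine not_isSolvable_of_transvection_mem_fin_two hF _ hK ?_
  exact Group.isSolvable_of_isSolvable_injective (f := f.subgroupComap K)
    fun x y h ↦ Subtype.ext (hf (congrArg Subtype.val h))

theorem ContainsTransvections.not_linearIndependent {K : Subgroup (SpecialLinearGroup ι F)}
    [Group.IsSolvable K] {w : Fin 3 → ι → F} (hw : ∀ i, ContainsTransvections K (w i)) :
    ¬ LinearIndependent F w := by
  intro hli
  obtain ⟨f, hf, hK⟩ := ContainsTransvections.exists_ofSplit hw hli
  refine not_isSolvable_of_transvection_mem_fin_three _ hK ?_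
  exact Group.isSolvable_of_isSolvable_injective (f := f.subgroupComap K)
    fun x y h ↦ Subtype.ext (hf (congrArg Subtype.val h))

/-- If a solvable group `K` contains all transvections along `v`, then the orbit of `v` spans a
space of dimension at most two, and of dimension at most one when the field has more than three
elements. -/
theorem ContainsTransvections.orbit_subset_span [Finite F]
    {K : Subgroup (SpecialLinearGroup ι F)} [Group.IsSolvable K] {v : ι → F} (hv : v ≠ 0)
    (hK : ContainsTransvections K v) :
    (∀ h ∈ K, h.1 *ᵥ v ∈ Submodule.span F {v}) ∨
      Nat.card F ≤ 3 ∧ ∃ h₀ ∈ K, LinearIndependent F ![v, h₀.1 *ᵥ v] ∧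
        ∀ h ∈ K, h.1 *ᵥ v ∈ Submodule.span F {v, h₀.1 *ᵥ v} := by
  rw [or_iff_not_imp_left]
  intro H
  push Not at H
  obtain ⟨h₀, hh₀, hmem⟩ := H
  have hli : LinearIndependent F ![v, h₀.1 *ᵥ v] := by
    rw [LinearIndependent.pair_iff' hv]
    exact fun a ha ↦ hmem (Submodule.mem_span_singleton.2 ⟨a, ha⟩)
  refine ⟨ContainsTransvections.card_le_three (K := K) (w := ![v, h₀.1 *ᵥ v]) ?_ hli,
    h₀, hh₀, hli, fun h hh ↦ ?_⟩
  · simp [Fin.forall_fin_two, hK, hK.mulVec hh₀]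
  · by_contra hspan
    refine ContainsTransvections.not_linearIndependent (K := K)
      (w := Matrix.vecCons (h.1 *ᵥ v) ![v, h₀.1 *ᵥ v]) ?_ ?_
    · simp [Fin.forall_fin_succ, hK, hK.mulVec hh₀, hK.mulVec hh]
    · refine linearIndependent_finCons.2 ⟨hli, ?_⟩
      simpa [Set.pair_comm] using hspan

/-- The inverse transpose automorphism of the special linear group. -/
def invTranspose : SpecialLinearGroup ι F →* SpecialLinearGroup ι F where
  toFun g := g⁻¹.transpose
  map_one' := Subtype.ext (by simp)
  map_mul' g h := Subtype.ext (by simp)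

theorem invTranspose_injective :
    Function.Injective (invTranspose : SpecialLinearGroup ι F →* SpecialLinearGroup ι F) := by
  intro g h hgh
  have h1 : g⁻¹.1ᵀ = h⁻¹.1ᵀ := congrArg Subtype.val hgh
  exact inv_injective (Subtype.ext (transpose_injective h1))

theorem coe_inv_eq_of_mul_eq_one {g : SpecialLinearGroup ι F} {N : Matrix ι ι F}
    (h : g.1 * N = 1) : g⁻¹.1 = N := by
  rw [← Matrix.mul_one g⁻¹.1, ← h, ← Matrix.mul_assoc, ← coe_mul]
  simp

/-- The unipotent radical of the stabilizer of the flag `span {v} ≤ ker f`. -/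
def flagUnipotent (v f : ι → F) (hfv : f ⬝ᵥ v = 0) : Subgroup (SpecialLinearGroup ι F) where
  carrier := {g | ∃ a b : ι → F, a ⬝ᵥ v = 0 ∧ f ⬝ᵥ b = 0 ∧
    g.1 = 1 + vecMulVec v a + vecMulVec b f}
  one_mem' := ⟨0, 0, by simp⟩
  mul_mem' := by
    rintro g g' ⟨a, b, ha, hb, hg⟩ ⟨a', b', ha', hb', hg'⟩
    refine ⟨a + a' + (a ⬝ᵥ b') • f, b + b', by simp [ha, ha', hfv], by simp [hb, hb'], ?_⟩
    rw [coe_mul, hg, hg']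
    simp only [Matrix.add_mul, Matrix.mul_add, Matrix.one_mul, Matrix.mul_one,
      vecMulVec_mul_vecMulVec, ha, hfv, hb', zero_smul, vecMulVec_zero, vecMulVec_add,
      add_vecMulVec]
    abel
  inv_mem' := by
    rintro g ⟨a, b, ha, hb, hg⟩
    refine ⟨-a + (a ⬝ᵥ b) • f, -b, by simp [ha, hfv], by simp [hb],
      coe_inv_eq_of_mul_eq_one ?_⟩
    rw [hg]
    simp only [Matrix.add_mul, Matrix.mul_add, Matrix.one_mul, Matrix.mul_one,
      vecMulVec_mul_vecMulVec, ha, hfv, hb, zero_smul, vecMulVec_zero, vecMulVec_add,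
      vecMulVec_neg, neg_vecMulVec, Matrix.mul_neg]
    abel

theorem isPGroup_flagUnipotent {r : ℕ} [Fact r.Prime] [CharP F r] (v f : ι → F)
    (hfv : f ⬝ᵥ v = 0) : IsPGroup r (flagUnipotent v f hfv) := by
  rintro ⟨g, a, b, ha, hb, hg⟩
  refine ⟨2, Subtype.ext (Subtype.ext ?_)⟩
  cases isEmpty_or_nonempty ι
  · exact Subsingleton.elim _ _
  set M := vecMulVec v a + vecMulVec b f with hM
  have h3 : M ^ 3 = 0 := by
    simp only [pow_succ, pow_zero, hM, Matrix.add_mul, Matrix.mul_add, Matrix.one_mul,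
      vecMulVec_mul_vecMulVec, ha, hfv, hb, zero_smul, vecMulVec_zero, add_zero, zero_add,
      vecMulVec_smul, Matrix.smul_mul, smul_zero]
  have hr : 3 ≤ r ^ 2 := by nlinarith [(Fact.out : r.Prime).two_le]
  change (g ^ r ^ 2).1 = 1
  rw [coe_pow, hg, add_assoc, ← hM, add_pow_char_pow_of_commute r 2 (Commute.one_left M), one_pow,
    pow_eq_zero_of_le hr h3, add_zero]

theorem exists_containsTransvections {r : ℕ} [Fact r.Prime] [CharP F r]
    {K : Subgroup (SpecialLinearGroup ι F)} (hK : ¬ r ∣ K.index) {v f : ι → F} (hv : v ≠ 0)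
    (hf : f ≠ 0) (hfv : f ⬝ᵥ v = 0) :
    ∃ v' f' : ι → F, v' ≠ 0 ∧ f' ≠ 0 ∧ f' ⬝ᵥ v' = 0 ∧ ContainsTransvections K v' ∧
      ContainsTransvections (K.comap invTranspose) f' := by
  obtain ⟨c, hc⟩ :=
    (isPGroup_flagUnipotent (r := r) v f hfv).nonempty_fixed_point_of_prime_not_dvd_card
      (SpecialLinearGroup ι F ⧸ K) hK
  obtain ⟨g, rfl⟩ := QuotientGroup.mk_surjective c
  have hgU (u : SpecialLinearGroup ι F) (hu : g * u * g⁻¹ ∈ flagUnipotent v f hfv) : u ∈ K := by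
    have : ((g * u * g⁻¹ * g : SpecialLinearGroup ι F) : SpecialLinearGroup ι F ⧸ K) = g :=
      hc ⟨_, hu⟩
    rw [inv_mul_cancel_right, eq_comm, QuotientGroup.eq, inv_mul_cancel_left] at this
    exact this
  have h1 : g⁻¹.1 * g.1 = 1 := by rw [← coe_mul]; simp
  have h2 : g.1 * g⁻¹.1 = 1 := by rw [← coe_mul]; simp
  have hgv : g.1 *ᵥ (g⁻¹.1 *ᵥ v) = v := by rw [mulVec_mulVec, h2, one_mulVec]
  have hfg : (f ᵥ* g.1) ᵥ* g⁻¹.1 = f := by rw [vecMul_vecMul, h2, vecMul_one]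
  have conj (x y : ι → F) : g.1 * (1 + vecMulVec x y) * g⁻¹.1 =
      1 + vecMulVec (g.1 *ᵥ x) (y ᵥ* g⁻¹.1) := by
    rw [Matrix.mul_add, Matrix.add_mul, Matrix.mul_one, h2, mul_vecMulVec, vecMulVec_mul]
  refine ⟨g⁻¹.1 *ᵥ v, f ᵥ* g.1, ?_, ?_, ?_, ?_, ?_⟩
  · intro h; rw [h, mulVec_zero] at hgv; exact hv hgv.symm
  · intro h; rw [h, zero_vecMul] at hfg; exact hf hfg.symm
  · rw [← dotProduct_mulVec, hgv, hfv]
  · intro u a ha hu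
    refine hgU u ⟨a ᵥ* g⁻¹.1, 0, by rwa [← dotProduct_mulVec], by simp, ?_⟩
    rw [coe_mul, coe_mul, hu, conj, hgv]
    simp
  · intro u a ha hu
    have hinv : u⁻¹.1 = 1 + vecMulVec (f ᵥ* g.1) (-a) := by
      apply coe_inv_eq_of_mul_eq_one
      rw [hu]
      simp [Matrix.add_mul, Matrix.mul_add, vecMulVec_mul_vecMulVec, ha, vecMulVec_neg]
    refine hgU _ ⟨0, g.1 *ᵥ (-a), by simp, ?_, ?_⟩
    · rw [dotProduct_mulVec, dotProduct_comm, neg_dotProduct, ha, neg_zero]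
    · have : (invTranspose u).1 = 1 + vecMulVec (-a) (f ᵥ* g.1) := by
        change u⁻¹.1ᵀ = _
        rw [hinv, transpose_add, transpose_one, transpose_vecMulVec]
      rw [coe_mul, coe_mul, this, conj, hfg]
      simp

theorem dotProduct_mulVec_eq_zero {K : Subgroup (SpecialLinearGroup ι F)} {f y : ι → F}
    {s : Set (ι → F)} (hs : ∀ h ∈ K.comap invTranspose, h.1 *ᵥ f ∈ Submodule.span F s)
    (hy : ∀ a ∈ s, a ⬝ᵥ y = 0) {h : SpecialLinearGroup ι F} (hh : h ∈ K) :
    f ⬝ᵥ (h.1 *ᵥ y) = 0 := by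
  have hmem : h.transpose ∈ K.comap invTranspose := by
    have : invTranspose h.transpose = h⁻¹ := by
      refine Subtype.ext ?_
      change (h.transpose)⁻¹.1ᵀ = h⁻¹.1
      rw [SpecialLinearGroup.coe_inv, SpecialLinearGroup.coe_inv, adjugate_transpose]
      rfl
    rw [Subgroup.mem_comap, this]
    exact K.inv_mem hh
  rw [dotProduct_mulVec, ← mulVec_transpose]
  refine Submodule.span_induction (p := fun a _ ↦ a ⬝ᵥ y = 0) hy (by simp) ?_ ?_ (hs _ hmem)
  · intro a b _ _ ha hb
    rw [add_dotProduct, ha, hb, add_zero]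
  · intro c a _ ha
    rw [smul_dotProduct, ha, smul_zero]

/-- If `K` has prime power index and fixes the line spanned by `v`, then the `K`-orbit of a vector
outside this line is not contained in a hyperplane containing `v`. -/
theorem false_of_fixed_line [Finite F] {K : Subgroup (SpecialLinearGroup ι F)} {p k j : ℕ}
    (hk : k ≠ 0) (hX : Nat.card (Projectivization F (ι → F)) = p ^ k) (hK : K.index = p ^ j)
    {v f y : ι → F} (hv : v ≠ 0) (hf : f ≠ 0) (hfv : f ⬝ᵥ v = 0)
    (hKv : ∀ h ∈ K, h.1 *ᵥ v ∈ Submodule.span F {v}) (hy : y ∉ Submodule.span F {v})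
    (hKy : ∀ h ∈ K, f ⬝ᵥ (h.1 *ᵥ y) = 0) : False := by
  have hy0 : y ≠ 0 := by
    rintro rfl
    exact hy (zero_mem _)
  obtain ⟨z, hz⟩ : ∃ z, f ⬝ᵥ z ≠ 0 := by
    by_contra! h
    exact hf (dotProduct_eq_zero f h)
  have hz0 : z ≠ 0 := by
    rintro rfl
    exact hz (dotProduct_zero f)
  have hxz : Projectivization.mk F v hv ≠ Projectivization.mk F z hz0 := by
    rw [Ne, Projectivization.mk_eq_mk_iff']
    rintro ⟨a, rfl⟩
    rw [dotProduct_smul, smul_eq_zero] at hfv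
    obtain rfl := hfv.resolve_right hz
    exact hv (zero_smul _ _)
  have hxy : Projectivization.mk F v hv ≠ Projectivization.mk F y hy0 := by
    rw [Ne, eq_comm, Projectivization.mk_eq_mk_iff']
    exact fun h ↦ hy (Submodule.mem_span_singleton.2 h)
  have hcard := pred_card_le_ncard_of_two_pretransitive hk hX hK hxy
    (T := {Projectivization.mk F v hv} ×ˢ
      ({Projectivization.mk F v hv, Projectivization.mk F z hz0}ᶜ :
        Set (Projectivization F (ι → F)))) ?_
  · have h2 := Set.ncard_pair hxz
    have h3 := Set.ncard_add_ncard_compl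
      {Projectivization.mk F v hv, Projectivization.mk F z hz0}
    rw [Set.ncard_prod, Set.ncard_singleton, one_mul] at hcard
    lia
  · intro h hh
    have hfix : h • Projectivization.mk F v hv = Projectivization.mk F v hv := by
      rw [Projectivization.smul_mk, Projectivization.mk_eq_mk_iff']
      exact Submodule.mem_span_singleton.1 (hKv h hh)
    refine ⟨hfix, ?_⟩
    rintro (hx | hz')
    · exact hxy (MulAction.injective h (hfix.trans hx.symm))
    · obtain ⟨a, ha⟩ := (Projectivization.mk_eq_mk_iff' ..).1
        (Eq.symm hz' : Projectivization.mk F z hz0 = h • Projectivization.mk F y hy0)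
      refine hz ?_
      rw [← ha, dotProduct_smul]
      exact (congrArg (a • ·) (hKy h hh)).trans (smul_zero a)

theorem card_projectivization_le_of_orbit_subset [Finite F]
    {K : Subgroup (SpecialLinearGroup ι F)} {p k j : ℕ}
    (hk : k ≠ 0) (hX : Nat.card (Projectivization F (ι → F)) = p ^ k) (hK : K.index = p ^ j)
    {v : ι → F} {h₀ : SpecialLinearGroup ι F} (hh₀ : h₀ ∈ K)
    (hli : LinearIndependent F ![v, h₀.1 *ᵥ v])
    (hspan : ∀ h ∈ K, h.1 *ᵥ v ∈ Submodule.span F {v, h₀.1 *ᵥ v}) :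
    Nat.card (Projectivization F (ι → F)) - 1 ≤ (Nat.card F + 1) ^ 2 := by
  set w := h₀.1 *ᵥ v with hw
  have hv : v ≠ 0 := hli.ne_zero 0
  have hpair := (LinearIndependent.pair_iff' hv).1 hli
  have hw0 (t : F) : w + t • v ≠ 0 := fun h ↦ hpair (-t) (by
    rw [neg_smul]; exact (eq_neg_of_add_eq_zero_left h).symm)
  let φ : Option F → Projectivization F (ι → F) :=
    fun t ↦ t.elim (Projectivization.mk F v hv) fun t ↦ Projectivization.mk F _ (hw0 t)
  have hφ (u : ι → F) (hu : u ≠ 0) (hmem : u ∈ Submodule.span F {v, w}) :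
      Projectivization.mk F u hu ∈ Set.range φ := by
    obtain ⟨a, b, rfl⟩ := Submodule.mem_span_pair.1 hmem
    by_cases hb : b = 0
    · refine ⟨none, Eq.symm ((Projectivization.mk_eq_mk_iff' ..).2 ⟨a, ?_⟩)⟩
      simp [hb]
    · refine ⟨some (b⁻¹ * a), Eq.symm ((Projectivization.mk_eq_mk_iff' ..).2 ⟨b, ?_⟩)⟩
      rw [smul_add, smul_smul, mul_inv_cancel_left₀ hb, add_comm]
  have hxy : Projectivization.mk F v hv ≠ h₀ • Projectivization.mk F v hv := by
    rw [Projectivization.smul_mk, Ne, eq_comm, Projectivization.mk_eq_mk_iff']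
    rintro ⟨a, ha⟩
    exact hpair a ha
  have hK' (h : SpecialLinearGroup ι F) (hh : h ∈ K) :
      h • Projectivization.mk F v hv ∈ Set.range φ := by
    rw [Projectivization.smul_mk]
    exact hφ _ _ (hspan h hh)
  have hcard := pred_card_le_ncard_of_two_pretransitive hk hX hK hxy
    (T := Set.range φ ×ˢ Set.range φ) fun h hh ↦
      ⟨hK' h hh, by rw [smul_smul]; exact hK' _ (mul_mem hh hh₀)⟩
  rw [Set.ncard_prod, ← pow_two] at hcard
  refine hcard.trans (Nat.pow_le_pow_left ?_ 2)
  rw [← Set.image_univ]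
  refine (Set.ncard_image_le (Set.toFinite _)).trans ?_
  rw [Set.ncard_univ, Finite.card_option]

theorem eq_three_and_card_le_three [Finite F] {n : ℕ} (hn : 3 ≤ n)
    {K : Subgroup (SpecialLinearGroup (Fin n) F)} [Group.IsSolvable K] {r p k j : ℕ} [Fact r.Prime]
    [CharP F r] (hrp : ¬ r ∣ p ^ j) (hX : Nat.card (Projectivization F (Fin n → F)) = p ^ k)
    (hK : K.index = p ^ j) : n = 3 ∧ Nat.card F ≤ 3 := by
  have hsum : Nat.card (Projectivization F (Fin n → F)) = ∑ i ∈ Finset.range n, Nat.card F ^ i :=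
    Projectivization.card_of_finrank F (Fin n → F) (by simp)
  have hq : 1 < Nat.card F := Finite.one_lt_card
  have hsum_ge {m : ℕ} (hm : m ≤ n) : ∑ i ∈ Finset.range m, Nat.card F ^ i ≤ p ^ k := by
    rw [← hX, hsum]
    exact Finset.sum_le_sum_of_subset (Finset.range_mono hm)
  have hk : k ≠ 0 := by
    rintro rfl
    have := hsum_ge hn
    simp [Finset.sum_range_succ] at this
    lia
  have e0 : (⟨0, by lia⟩ : Fin n) ≠ ⟨1, by lia⟩ := by simp
  obtain ⟨v, f, hv, hf, hfv, hKv, hKf⟩ := exists_containsTransvections (r := r) (hK ▸ hrp)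
    (v := Pi.single ⟨0, by lia⟩ 1) (f := Pi.single ⟨1, by lia⟩ 1) (by simp) (by simp)
    (by simp [e0])
  rcases hKv.orbit_subset_span hv with h1 | ⟨hq3, h₀, hh₀, hli, hspan⟩
  · have : Group.IsSolvable (K.comap invTranspose) :=
      Group.isSolvable_of_isSolvable_injective (f := invTranspose.subgroupComap K)
        fun x y h ↦ Subtype.ext (invTranspose_injective (congrArg Subtype.val h))
    rcases hKf.orbit_subset_span hf with h2 | ⟨hq3, h₀, hh₀, hli, hspan⟩
    · obtain ⟨y, hyv, hy⟩ := exists_notMem_span_mulVec_eq_zero (of ![f])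
        (by simpa using hn) v
      refine (false_of_fixed_line hk hX hK hv hf hfv h1 hyv fun h hh ↦
        dotProduct_mulVec_eq_zero h2 ?_ hh).elim
      rintro _ rfl
      exact congrFun hy 0
    · refine ⟨by_contra fun hn3 ↦ ?_, hq3⟩
      obtain ⟨y, hyv, hy⟩ := exists_notMem_span_mulVec_eq_zero (of ![f, h₀.1 *ᵥ f])
        (by rw [Fintype.card_fin]; lia) v
      refine (false_of_fixed_line hk hX hK hv hf hfv h1 hyv fun h hh ↦
        dotProduct_mulVec_eq_zero hspan ?_ hh).elim
      rintro _ (rfl | rfl)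
      · exact congrFun hy 0
      · exact congrFun hy 1
  · refine ⟨by_contra fun hn3 ↦ ?_, hq3⟩
    have hle := card_projectivization_le_of_orbit_subset hk hX hK hh₀ hli hspan
    have hge := hsum_ge (m := 4) (by lia)
    rw [hX] at hle
    simp only [Finset.sum_range_succ, Finset.sum_range_zero] at hge
    have : 2 ≤ Nat.card F := hq
    interval_cases Nat.card F <;> lia

end Matrix.SpecialLinearGroup

/-- Let `n ≥ 3`, let `q` be a prime power, and let `p` be a prime such that
`(q^n − 1)/(q − 1)` is a power of `p`. If `PSL_n(q)` has a solvable `p`-complement, then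
`n = 3`, `q = 2` and `p = 7`, or `n = 3`, `q = 3` and `p = 13`. -/
theorem psl_n_solvable_p_complement (n q p : ℕ) (hn : 3 ≤ n) (hq : IsPrimePow q)
    (hp : p.Prime) (hpow : ∃ k : ℕ, q ^ n - 1 = (q - 1) * p ^ k)
    (F : Type*) [Field F] [Fintype F] (hF : Fintype.card F = q)
    (H : Subgroup (ProjectiveSpecialLinearGroup (Fin n) F)) (hsolv : IsSolvable H)
    (hindex : ∃ k : ℕ, H.index = p ^ k)
    (hcop : Nat.Coprime (Nat.card H) p) :
    (n = 3 ∧ q = 2 ∧ p = 7) ∨ (n = 3 ∧ q = 3 ∧ p = 13) := by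
  obtain ⟨k, hk⟩ := hpow
  obtain ⟨j, hj⟩ := hindex
  have hFq : Nat.card F = q := Nat.card_eq_fintype_card.trans hF
  have hq1 : 1 < q := hq.one_lt
  have hX : Nat.card (Projectivization F (Fin n → F)) = p ^ k := by
    have := Projectivization.card F (Fin n → F)
    rw [Nat.card_fun, Nat.card_fin, hFq, hk, mul_comm] at this
    exact (Nat.eq_of_mul_eq_mul_right (by lia) this).symm
  obtain ⟨r, hr⟩ := CharP.exists F
  have : Fact r.Prime := ⟨CharP.char_is_prime F r⟩
  have hrq : r ∣ q := by
    rw [← CharP.cast_eq_zero_iff F r, ← hF, FiniteField.cast_card_eq_zero]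
  have hrp : ¬ r ∣ p ^ j := by
    intro h
    obtain rfl := (Nat.prime_dvd_prime_iff_eq Fact.out hp).1 (Nat.Prime.dvd_of_dvd_pow Fact.out h)
    have hk0 : k ≠ 0 := by
      rintro rfl
      have : q ^ 1 < q ^ n := Nat.pow_lt_pow_right hq1 (by lia)
      lia
    have h1 : r ∣ q ^ n - 1 := hk ▸ (dvd_pow_self r hk0).mul_left _
    have h2 : r ∣ q ^ n := hrq.trans (dvd_pow_self q (by lia))
    have h3 := (Nat.dvd_sub_iff_right (Nat.one_le_pow _ _ (by lia)) h2).1 h1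
    exact hp.one_lt.ne' (Nat.dvd_one.1 h3)
  let π := QuotientGroup.mk' (Subgroup.center (Matrix.SpecialLinearGroup (Fin n) F))
  have : Group.IsSolvable H := hsolv
  have : Group.IsSolvable (Subgroup.center (Matrix.SpecialLinearGroup (Fin n) F)) :=
    Group.isSolvable_of_comm fun a b ↦
      Subtype.ext (Subgroup.mem_center_iff.1 b.2 a)
  have : Group.IsSolvable (H.comap π) := by
    refine Group.isSolvable_of_ker_le_range
      (Subgroup.inclusion (QuotientGroup.le_comap_mk' _ H)) (π.subgroupComap H) fun x hx ↦ ?_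
    have hx' : π x = 1 := congrArg Subtype.val hx
    exact ⟨⟨x, (QuotientGroup.eq_one_iff _).1 hx'⟩, rfl⟩
  have hindex : (H.comap π).index = p ^ j := by
    rw [Subgroup.index_comap_of_surjective _ (QuotientGroup.mk'_surjective _), hj]
  obtain ⟨rfl, hq3⟩ := Matrix.SpecialLinearGroup.eq_three_and_card_le_three hn hrp hX hindex
  rw [hFq] at hq3
  have hpk {P : ℕ} (hP : P.Prime) (h : p ^ k = P) : p = P :=
    ((Nat.prime_dvd_prime_iff_eq hP hp).1 (hP.dvd_of_dvd_pow h.symm.dvd)).symm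
  interval_cases q
  · exact Or.inl ⟨rfl, rfl, hpk (by norm_num) (by lia)⟩
  · exact Or.inr ⟨rfl, rfl, hpk (by norm_num) (by lia)⟩
end
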